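/- Assume (H1), (H2), (H3″) (i.e. α̲_Γ := inf_{x̄∈Γ} α̲_{δ_Γ}(x̄) > −t), upper Ahlfors regularity (H4′) and lower Ahlfors regularity (H4″). Suppose Γ = ∂Ω and that α̲_Γ > n(θ_Γ(x̄) − 1) − t for all x̄ ∈ Γ. Let u ∈ N^{s,p}(Ω) and let Tu : Γ → ℝ be H^t-measurable such that for H^t-almost every x̄ ∈ Γ, g(x;u) → Tu(x̄) as x → x̄ with x ∈ Q_{λ₀}(x̄). Then, for H^t-almost every x̄ ∈ Γ, lim_{ρ→0⁺} ⨍_{Ω∩B(x̄,ρ)} |Tu(x̄) − u(x)|ᵖ dx = 0. -/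

import Mathlib

open MeasureTheory Metric Set Filter
open scoped ENNReal NNReal Topology

noncomputable section

abbrev Euc (n : ℕ) := EuclideanSpace ℝ (Fin n)

variable {n : ℕ}

/-- Distance to the boundary of `Ω`. -/
def dB (Ω : Set (Euc n)) (x : Euc n) : ℝ := infDist x (frontier Ω)

/-- `Ψ(x) = B(x, d(x)/2)`. -/
def PsiB (Ω : Set (Euc n)) (x : Euc n) : Set (Euc n) := ball x (dB Ω x / 2)

/-- `Φ(x) = B(x, d(x)/6)`. -/
def PhiB (Ω : Set (Euc n)) (x : Euc n) : Set (Euc n) := ball x (dB Ω x / 6)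

/-- The integrand of `ν(·;u)`. -/
def nuInt (Ω : Set (Euc n)) (s : Euc n → ℝ) (p : ℝ) (u : Euc n → ℝ) (x : Euc n) : ℝ :=
  (⨍ y in PsiB Ω x, |u y - u x|) ^ p * dB Ω x ^ (-(p * s x))

/-- `ν(E;u)`. -/
def nuM (Ω : Set (Euc n)) (s : Euc n → ℝ) (p : ℝ) (u : Euc n → ℝ) (E : Set (Euc n)) : ℝ :=
  ∫ x in Ω ∩ E, nuInt Ω s p u x

/-- Membership in the nonlocal space `𝒩^{s,p}(Ω)`: `u ∈ L¹(Ω)` and `ν(Ω;u) < ∞`. -/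
def MemN (Ω : Set (Euc n)) (s : Euc n → ℝ) (p : ℝ) (u : Euc n → ℝ) : Prop :=
  IntegrableOn u Ω volume ∧ IntegrableOn (nuInt Ω s p u) Ω volume

/-- `g(x;u)`, the mean of `u` over `Φ(x)`. -/
def gFun (Ω : Set (Euc n)) (u : Euc n → ℝ) (x : Euc n) : ℝ := ⨍ y in PhiB Ω x, u y

/-- The approach region `Q^θ_λ(xb)`. -/
def Qreg (Ω : Set (Euc n)) (lam θ : ℝ) (xb : Euc n) : Set (Euc n) :=
  {x | x ∈ Ω ∧ (lam * dist xb x) ^ θ < dB Ω x}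

/-- `Q` is an `(η,θ)`-corkscrew region for `xb` with radius `δ₀`. -/
def IsCorkscrew (Ω Q : Set (Euc n)) (xb : Euc n) (η θ δ₀ : ℝ) : Prop :=
  ∀ δ : ℝ, 0 < δ → δ ≤ δ₀ →
    ∃ x ∈ Q, η * δ < dist xb x ∧ dist xb x < δ ∧ (η * δ) ^ θ < dB Ω x

/-- `E` is `(C,θ)`-connected to `xb`, with radius `ρ₀` and gauge `ε`. -/
def ConnectedTo (Ω E : Set (Euc n)) (xb : Euc n) (C θ ρ₀ : ℝ) (ε : ℝ → ℝ) : Prop :=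
  ∀ lam : ℝ, 0 < lam → lam < 1 →
    0 < ε lam ∧ ε lam ≤ lam ∧
      ∀ ρ : ℝ, 0 < ρ → ρ ≤ ρ₀ → ∀ x ∈ E ∩ ball xb ρ, ∀ x' ∈ E ∩ ball xb ρ,
        (lam * ρ) ^ θ ≤ dB Ω x → (lam * ρ) ^ θ ≤ dB Ω x' →
        ∃ γ : ℝ → Euc n, ContinuousOn γ (Icc 0 1) ∧ γ 0 = x ∧ γ 1 = x' ∧
          (∀ τ ∈ Icc (0:ℝ) 1, γ τ ∈ E ∧ ε lam * ρ ^ θ ≤ dB Ω (γ τ)) ∧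
          eVariationOn γ (Icc 0 1) ≤ ENNReal.ofReal (C * ρ)

/-- The piecewise bilinear function `α(s,θ)`. -/
def alphaFun (n : ℕ) (p sv θ : ℝ) : ℝ :=
  if p * sv - n ≤ p - 1 then p * (1 - θ) + (p * sv - n) * θ
  else (1 - θ) + (p * sv - n)

/-- `s̲_δ(xb)`. -/
def sLow (Ω : Set (Euc n)) (s : Euc n → ℝ) (xb : Euc n) (δ : ℝ) : ℝ :=
  sInf (s '' (Ω ∩ ball xb δ))

/-- `α̲_δ(xb)`. -/
def alphaLow (Ω : Set (Euc n)) (s : Euc n → ℝ) (p : ℝ) (θΓ : Euc n → ℝ)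
    (xb : Euc n) (δ : ℝ) : ℝ :=
  alphaFun n p (sLow Ω s xb δ) (θΓ xb)

/-- `α̲_0(xb) = lim_{δ → 0⁺} α̲_δ(xb)`. -/
def alphaLow0 (Ω : Set (Euc n)) (s : Euc n → ℝ) (p : ℝ) (θΓ : Euc n → ℝ) (xb : Euc n) : ℝ :=
  limUnder (𝓝[>] (0:ℝ)) (fun δ => alphaLow Ω s p θΓ xb δ)

/-- `Γ_τ`: points of `Γ` where `limsup_{ρ→0⁺} ρ^{-τ} ν(B(xb,ρ);u) < ∞`. -/
def GammaTau (Ω : Set (Euc n)) (s : Euc n → ℝ) (p : ℝ) (u : Euc n → ℝ)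
    (Γ : Set (Euc n)) (τ : ℝ) : Set (Euc n) :=
  {xb ∈ Γ | ∃ M : ℝ, ∀ᶠ ρ in 𝓝[>] (0:ℝ), ρ ^ (-τ) * nuM Ω s p u (ball xb ρ) ≤ M}

/-- `M_τ(xb) = sup_{0<ρ≤δΓ} ρ^{-τ} ν(B(xb,ρ);u)`. -/
def Mtau (Ω : Set (Euc n)) (s : Euc n → ℝ) (p : ℝ) (u : Euc n → ℝ)
    (δΓ τ : ℝ) (xb : Euc n) : ℝ :=
  sSup ((fun ρ => ρ ^ (-τ) * nuM Ω s p u (ball xb ρ)) '' Ioc 0 δΓ)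

lemma dB_nonneg (Ω : Set (Euc n)) (x : Euc n) : 0 ≤ dB Ω x := infDist_nonneg

lemma dB_le_add (Ω : Set (Euc n)) (x y : Euc n) : dB Ω x ≤ dB Ω y + dist x y :=
  infDist_le_infDist_add_dist

lemma dB_le_dist {Ω : Set (Euc n)} {x z : Euc n} (hz : z ∈ frontier Ω) : dB Ω x ≤ dist x z :=
  infDist_le_dist_of_mem hz

lemma dB_pos {Ω : Set (Euc n)} (hΩ : IsOpen Ω) (hfr : (frontier Ω).Nonempty) {x : Euc n}
    (hx : x ∈ Ω) : 0 < dB Ω x := by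
  refine (isClosed_frontier.notMem_iff_infDist_pos hfr).1 ?_
  intro h
  rw [hΩ.frontier_eq] at h
  exact h.2 hx

lemma ball_dB_subset {Ω : Set (Euc n)} (hΩ : IsOpen Ω) {x : Euc n}
    (hx : x ∈ Ω) {r : ℝ} (hr : r ≤ dB Ω x) : ball x r ⊆ Ω := by
  rcases le_or_gt r 0 with h0 | h0
  · rw [ball_eq_empty.2 h0]; exact empty_subset _
  have hpc : IsPreconnected (ball x r) := (convex_ball x r).isPreconnected
  intro y hy
  by_contra hyΩ
  have hsub : ball x r ⊆ Ω ∪ (closure Ω)ᶜ := by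
    intro w hw
    by_cases hwΩ : w ∈ interior Ω
    · exact Or.inl (interior_subset hwΩ)
    right
    intro hwc
    have h1 : dB Ω x ≤ dist x w := dB_le_dist ⟨hwc, hwΩ⟩
    rw [mem_ball, dist_comm] at hw
    linarith
  obtain ⟨w, -, hw1, hw2⟩ := hpc Ω (closure Ω)ᶜ hΩ isClosed_closure.isOpen_compl hsub
    ⟨x, mem_ball_self h0, hx⟩ ⟨y, hy, (hsub hy).resolve_left hyΩ⟩
  exact hw2 (subset_closure hw1)

/-- abbreviation for the inner mean -/
def Amean (Ω : Set (Euc n)) (u : Euc n → ℝ) (w : Euc n) : ℝ := ⨍ y in PsiB Ω w, |u y - u w|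

lemma Amean_nonneg (Ω : Set (Euc n)) (u : Euc n → ℝ) (w : Euc n) : 0 ≤ Amean Ω u w := by
  unfold Amean
  rw [setAverage_eq]
  exact smul_nonneg (by positivity) (integral_nonneg fun _ => abs_nonneg _)

lemma vol_ball (hn : 1 ≤ n) (x : Euc n) {r : ℝ} (hr : 0 ≤ r) :
    volume.real (ball x r) = r ^ n * volume.real (ball (0 : Euc n) 1) := by
  have : Nonempty (Fin n) := ⟨⟨0, hn⟩⟩
  have := Measure.addHaar_ball (volume : Measure (Euc n)) x hr
  rw [Measure.real, this, ENNReal.toReal_mul, ENNReal.toReal_ofReal (by positivity)]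
  simp [Measure.real]

lemma vol_one_pos : 0 < volume.real (ball (0 : Euc n) 1) := by
  rw [Measure.real]
  exact ENNReal.toReal_pos (measure_ball_pos _ _ one_pos).ne' measure_ball_lt_top.ne

lemma mean_sub_le (hn : 1 ≤ n) {Ω : Set (Euc n)} {u : Euc n → ℝ} (hu : IntegrableOn u Ω volume)
    {y w : Euc n} {r R : ℝ} (hr : 0 < r) (hR : R ≤ 4 * r) (hsub : ball y r ⊆ ball w R)
    (hΩ : ball w R ⊆ Ω) (c : ℝ) :
    |(⨍ z in ball y r, u z) - c| ≤ 4 ^ n * ⨍ z in ball w R, |u z - c| := by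
  have hRpos : 0 < R := by
    by_contra h
    have : ball w R = ∅ := ball_eq_empty.2 (not_lt.1 h)
    rw [this] at hsub
    exact hsub (mem_ball_self hr)
  have hv := vol_one_pos (n := n)
  have hiR : IntegrableOn (fun z => u z - c) (ball w R) volume :=
    (hu.mono_set hΩ).sub (integrableOn_const measure_ball_lt_top.ne)
  have hir : IntegrableOn (fun z => u z - c) (ball y r) volume := hiR.mono_set hsub
  have hur : IntegrableOn u (ball y r) volume := hu.mono_set (hsub.trans hΩ)
  have hvr : volume.real (ball y r) ≠ 0 := by
    rw [vol_ball hn y hr.le]; positivity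
  have e1 : (⨍ z in ball y r, u z) - c
      = (volume.real (ball y r))⁻¹ * ∫ z in ball y r, (u z - c) := by
    rw [setAverage_eq, integral_sub hur (integrableOn_const measure_ball_lt_top.ne),
      setIntegral_const, smul_eq_mul, smul_eq_mul]
    field_simp
  rw [e1, abs_mul, abs_of_nonneg (by positivity : 0 ≤ (volume.real (ball y r))⁻¹),
    setAverage_eq, smul_eq_mul]
  have h2 : |∫ z in ball y r, (u z - c)| ≤ ∫ z in ball w R, |u z - c| := by
    refine (abs_integral_le_integral_abs).trans ?_
    exact setIntegral_mono_set hiR.abs (Eventually.of_forall fun _ => abs_nonneg _)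
      (LE.le.eventuallyLE hsub)
  have h3 : (volume.real (ball y r))⁻¹ ≤ 4 ^ n * (volume.real (ball w R))⁻¹ := by
    rw [vol_ball hn y hr.le, vol_ball hn w hRpos.le, ← div_eq_mul_inv, inv_eq_one_div,
      div_le_div_iff₀ (by positivity) (by positivity), one_mul, ← mul_assoc, ← mul_pow]
    gcongr
  calc _ ≤ (4 ^ n * (volume.real (ball w R))⁻¹) * ∫ z in ball w R, |u z - c| := by
        gcongr
    _ = _ := by ring

lemma g_sub_u_le (hn : 1 ≤ n) {Ω : Set (Euc n)} (hΩ : IsOpen Ω) (hfr : (frontier Ω).Nonempty)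
    {u : Euc n → ℝ} (hu : IntegrableOn u Ω volume)
    {x y w : Euc n} (hx : x ∈ Ω) (hxy : dist x y ≤ dB Ω x / 20)
    (hw : w ∈ ball x (dB Ω x / 6)) :
    |gFun Ω u y - u w| ≤ 4 ^ n * Amean Ω u w := by
  have hd := dB_pos hΩ hfr hx
  rw [mem_ball] at hw
  have hwΩ : w ∈ Ω := ball_dB_subset hΩ hx le_rfl (by rw [mem_ball]; linarith)
  have h1 := dB_le_add Ω x y
  have h2 := dB_le_add Ω y x
  have h3 := dB_le_add Ω x w
  have h4 := dB_le_add Ω w x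
  rw [dist_comm y x] at h2
  rw [dist_comm x w] at h3
  refine mean_sub_le hn hu (y := y) (w := w) (r := dB Ω y / 6) (R := dB Ω w / 2)
    (by linarith) (by linarith) ?_ (ball_dB_subset hΩ hwΩ (by linarith [dB_nonneg Ω w])) (u w)
  apply ball_subset_ball'
  have := dist_triangle y x w
  rw [dist_comm y x, dist_comm x w] at this
  linarith

lemma chain_aux (γ : ℝ → Euc n) (f D : Euc n → ℝ) (K c r0 R : ℝ)
    (hγ : ContinuousOn γ (Icc 0 1)) (hr0 : 0 < r0) (hc : 0 < c) (hK : 0 ≤ K)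
    (hD : ∀ τ ∈ Icc (0:ℝ) 1, r0 ≤ D (γ τ)) (hDR : ∀ τ ∈ Icc (0:ℝ) 1, D (γ τ) ≤ R)
    (hstep : ∀ τ ∈ Icc (0:ℝ) 1, ∀ τ' ∈ Icc (0:ℝ) 1, dist (γ τ) (γ τ') ≤ c * D (γ τ) →
      |f (γ τ) - f (γ τ')| ≤ K * D (γ τ)) (k : ℕ) :
    ∀ a ∈ Icc (0:ℝ) 1, ∀ V : ℝ, eVariationOn γ (Icc a 1) ≤ ENNReal.ofReal V → 0 ≤ V →
      V ≤ k * (c * r0) → |f (γ a) - f (γ 1)| ≤ K / c * V + K * R := by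
  have h1mem : (1:ℝ) ∈ Icc (0:ℝ) 1 := ⟨zero_le_one, le_rfl⟩
  induction k with
  | zero =>
    intro a ha V hV hV0 hVk
    have hV' : V = 0 := le_antisymm (by simpa using hVk) hV0
    have h1 := eVariationOn.edist_le γ (s := Icc a 1) (x := a) (y := 1) ⟨le_rfl, ha.2⟩ ⟨ha.2, le_rfl⟩
    have h2 : dist (γ a) (γ 1) ≤ 0 := by
      have := h1.trans hV
      rw [hV', ENNReal.ofReal_zero, edist_dist] at this
      simpa using this
    have h3 := hstep a ha 1 h1mem (h2.trans (mul_nonneg hc.le (hr0.le.trans (hD a ha))))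
    have h4 : K * D (γ a) ≤ K * R := mul_le_mul_of_nonneg_left (hDR a ha) hK
    rw [hV']; linarith
  | succ k ih =>
    intro a ha V hV hV0 hVk
    by_cases hd : dist (γ a) (γ 1) ≤ c * D (γ a)
    · have h3 := hstep a ha 1 h1mem hd
      have h4 : K * D (γ a) ≤ K * R := mul_le_mul_of_nonneg_left (hDR a ha) hK
      have : 0 ≤ K / c * V := by positivity
      linarith
    push Not at hd
    have hcont : ContinuousOn (fun τ => dist (γ a) (γ τ)) (Icc a 1) :=
      (continuous_const.dist continuous_id).comp_continuousOn (hγ.mono (Icc_subset_Icc_left ha.1))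
    have hDa : 0 < D (γ a) := hr0.trans_le (hD a ha)
    obtain ⟨τ, hτ, hτe⟩ := intermediate_value_Icc ha.2 hcont
      (show c * D (γ a) ∈ Icc (dist (γ a) (γ a)) (dist (γ a) (γ 1)) from
        ⟨by rw [dist_self]; positivity, hd.le⟩)
    have hτ01 : τ ∈ Icc (0:ℝ) 1 := ⟨ha.1.trans hτ.1, hτ.2⟩
    simp only at hτe
    have hadd := eVariationOn.add_le_union γ (s := Icc a τ) (t := Icc τ 1)
      (fun x hx y hy => hx.2.trans hy.1)
    rw [Icc_union_Icc_eq_Icc hτ.1 hτ.2] at hadd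
    have h1 := eVariationOn.edist_le γ (s := Icc a τ) (x := a) (y := τ) ⟨le_rfl, hτ.1⟩ ⟨hτ.1, le_rfl⟩
    rw [edist_dist, hτe] at h1
    have h2 : eVariationOn γ (Icc τ 1) ≤ ENNReal.ofReal (V - c * D (γ a)) := by
      rw [ENNReal.ofReal_sub _ (by positivity)]
      refine ENNReal.le_sub_of_add_le_left ENNReal.ofReal_ne_top ?_
      exact (add_le_add_left h1 _).trans (hadd.trans hV)
    have hVge : c * D (γ a) ≤ V := by
      have : ENNReal.ofReal (c * D (γ a)) ≤ ENNReal.ofReal V :=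
        h1.trans ((le_self_add).trans (hadd.trans hV))
      rwa [ENNReal.ofReal_le_ofReal_iff hV0] at this
    have h3 := ih τ hτ01 (V - c * D (γ a)) h2 (by linarith) (by
      have := mul_le_mul_of_nonneg_left (hD a ha) hc.le
      push_cast at hVk
      nlinarith)
    have h4 := hstep a ha τ hτ01 hτe.le
    have h5 : K / c * (V - c * D (γ a)) = K / c * V - K * D (γ a) := by
      field_simp
    have h6 := abs_sub_le (f (γ a)) (f (γ τ)) (f (γ 1))
    linarith

lemma chain_bound (γ : ℝ → Euc n) (f D : Euc n → ℝ) (K c r0 R V : ℝ)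
    (hγ : ContinuousOn γ (Icc 0 1)) (hr0 : 0 < r0) (hc : 0 < c) (hK : 0 ≤ K)
    (hD : ∀ τ ∈ Icc (0:ℝ) 1, r0 ≤ D (γ τ)) (hDR : ∀ τ ∈ Icc (0:ℝ) 1, D (γ τ) ≤ R)
    (hstep : ∀ τ ∈ Icc (0:ℝ) 1, ∀ τ' ∈ Icc (0:ℝ) 1, dist (γ τ) (γ τ') ≤ c * D (γ τ) →
      |f (γ τ) - f (γ τ')| ≤ K * D (γ τ))
    (hV : eVariationOn γ (Icc 0 1) ≤ ENNReal.ofReal V) (hV0 : 0 ≤ V) :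
    |f (γ 0) - f (γ 1)| ≤ K / c * V + K * R := by
  obtain ⟨k, hk⟩ := exists_nat_ge (V / (c * r0))
  refine chain_aux γ f D K c r0 R hγ hr0 hc hK hD hDR hstep k 0 ⟨le_rfl, zero_le_one⟩ V hV hV0 ?_
  rwa [div_le_iff₀ (by positivity)] at hk

lemma density_null (ν : Measure (Euc n)) [IsFiniteMeasure ν] (Γ : Set (Euc n))
    (hν : ν Γ = 0) (t : ℝ) (ht : 0 ≤ t) (c : ℝ≥0∞) (hc : c ≠ 0) (hct : c ≠ ∞)
    (A : Set (Euc n)) (hAΓ : A ⊆ Γ)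
    (hA : ∀ x ∈ A, ∃ᶠ ρ in 𝓝[>] (0:ℝ), c * ENNReal.ofReal (ρ ^ t) < ν (ball x ρ)) :
    μH[t] A = 0 := by
  have key : ∀ ε : ℝ≥0∞, 0 < ε → μH[t] A ≤ ENNReal.ofReal (10 ^ t) * (c⁻¹ * ε) := by
    intro ε hε
    obtain ⟨U, hU, hUo, hUε⟩ := Γ.exists_isOpen_lt_of_lt (μ := ν) ε (by rw [hν]; exact hε)
    have cover : ∀ j : ℕ, ∃ v : Set (Euc n × ℝ), v.Countable ∧
        (∀ q ∈ v, 0 < q.2 ∧ q.2 < 1 / ((j:ℝ) + 1) ∧ closedBall q.1 q.2 ⊆ U ∧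
          c * ENNReal.ofReal (q.2 ^ t) ≤ ν (closedBall q.1 q.2)) ∧
        (v.PairwiseDisjoint fun q => closedBall q.1 q.2) ∧
        A ⊆ ⋃ q : v, closedBall q.1.1 (5 * q.1.2) := by
      intro j
      let T : Set (Euc n × ℝ) := {q | 0 < q.2 ∧ q.2 < 1 / ((j:ℝ) + 1) ∧ closedBall q.1 q.2 ⊆ U ∧
          c * ENNReal.ofReal (q.2 ^ t) ≤ ν (closedBall q.1 q.2)}
      obtain ⟨v, hvT, hvd, hvc⟩ := Vitali.exists_disjoint_subfamily_covering_enlargement_closedBall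
        T (fun q => q.1) (fun q => q.2) (1 / ((j:ℝ) + 1)) (fun q hq => hq.2.1.le) 5 (by norm_num)
      refine ⟨v, ?_, fun q hq => hvT hq, hvd, ?_⟩
      · refine hvd.countable_of_nonempty_interior ?_
        intro q hq
        exact ⟨q.1, ball_subset_interior_closedBall (mem_ball_self (hvT hq).1)⟩
      · intro x hx
        have hxU : U ∈ 𝓝 x := hUo.mem_nhds (hU (hAΓ hx))
        obtain ⟨r, hr, hrU⟩ := Metric.nhds_basis_closedBall.mem_iff.1 hxU
        have hev : ∀ᶠ ρ in 𝓝[>] (0:ℝ), 0 < ρ ∧ ρ < min r (1 / ((j:ℝ) + 1)) :=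
          Ioo_mem_nhdsGT (lt_min hr (by positivity))
        obtain ⟨ρ, hρ, hρ0, hρr⟩ := ((hA x hx).and_eventually hev).exists
        have hT : (x, ρ) ∈ T := ⟨hρ0, hρr.trans_le (min_le_right _ _),
          (closedBall_subset_closedBall (hρr.le.trans (min_le_left _ _))).trans hrU,
          hρ.le.trans (measure_mono ball_subset_closedBall)⟩
        obtain ⟨b, hb, hbs⟩ := hvc (x, ρ) hT
        exact mem_iUnion.2 ⟨⟨b, hb⟩, hbs (mem_closedBall_self hρ0.le)⟩
    choose v hvcount hvprop hvdisj hvcov using cover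
    have hcnt : ∀ j, Countable (v j) := fun j => (hvcount j).to_subtype
    have hdiam : ∀ j, ∀ q : v j, ediam (closedBall q.1.1 (5 * q.1.2)) ≤
        ENNReal.ofReal (10 * q.1.2) := by
      intro j q
      have h0 := (hvprop j q q.2).1
      refine Metric.ediam_le fun x hx y hy => ?_
      rw [edist_dist]
      apply ENNReal.ofReal_le_ofReal
      rw [mem_closedBall] at hx hy
      have := dist_triangle_right x y q.1.1
      linarith
    have hle := Measure.hausdorffMeasure_le_liminf_tsum t A (l := atTop)
      (fun j : ℕ => ENNReal.ofReal (10 * (1 / ((j:ℝ) + 1)))) (by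
        have h := (tendsto_one_div_add_atTop_nhds_zero_nat (𝕜 := ℝ)).const_mul 10
        have h2 := (ENNReal.continuous_ofReal.tendsto _).comp h
        simp only [mul_zero, ENNReal.ofReal_zero] at h2
        exact h2)
      (fun j (q : v j) => closedBall q.1.1 (5 * q.1.2))
      (Eventually.of_forall fun j q => (hdiam j q).trans
        (ENNReal.ofReal_le_ofReal (by have := (hvprop j q q.2).2.1; linarith)))
      (Eventually.of_forall hvcov)
    refine hle.trans ?_
    refine (liminf_le_liminf (v := fun _ => ENNReal.ofReal (10 ^ t) * (c⁻¹ * ε))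
      (Eventually.of_forall fun j => ?_)).trans (liminf_const _).le
    calc ∑' q : v j, ediam (closedBall q.1.1 (5 * q.1.2)) ^ t
        ≤ ∑' q : v j, ENNReal.ofReal (10 ^ t) * (c⁻¹ * ν (closedBall q.1.1 q.1.2)) := by
          refine ENNReal.tsum_le_tsum fun q => ?_
          obtain ⟨h0, -, -, h1⟩ := hvprop j q q.2
          refine (ENNReal.rpow_le_rpow (hdiam j q) ht).trans ?_
          rw [ENNReal.ofReal_rpow_of_nonneg (by positivity) ht, Real.mul_rpow (by norm_num) h0.le,
            ENNReal.ofReal_mul (by positivity)]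
          gcongr
          calc ENNReal.ofReal (q.1.2 ^ t) = c⁻¹ * (c * ENNReal.ofReal (q.1.2 ^ t)) := by
                rw [← mul_assoc, ENNReal.inv_mul_cancel hc hct, one_mul]
            _ ≤ _ := by gcongr
      _ = ENNReal.ofReal (10 ^ t) * (c⁻¹ * ∑' q : v j, ν (closedBall q.1.1 q.1.2)) := by
          rw [ENNReal.tsum_mul_left, ENNReal.tsum_mul_left]
      _ ≤ ENNReal.ofReal (10 ^ t) * (c⁻¹ * ε) := by
          gcongr
          have := measure_biUnion (μ := ν) (hvcount j) (hvdisj j)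
            (fun q _ => measurableSet_closedBall)
          rw [← this]
          refine (measure_mono (iUnion₂_subset fun q hq => (hvprop j q hq).2.2.1)).trans hUε.le
  refine le_antisymm ?_ zero_le
  have hlim : Tendsto (fun ε : ℝ≥0∞ => ENNReal.ofReal (10 ^ t) * (c⁻¹ * ε)) (𝓝[>] 0) (𝓝 0) := by
    have h1 : Tendsto (fun ε : ℝ≥0∞ => ENNReal.ofReal (10 ^ t) * (c⁻¹ * ε)) (𝓝 0)
        (𝓝 (ENNReal.ofReal (10 ^ t) * (c⁻¹ * 0))) := by
      refine ENNReal.Tendsto.const_mul (ENNReal.Tendsto.const_mul tendsto_id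
        (Or.inr (by simpa using hc))) (Or.inr ENNReal.ofReal_ne_top)
    simp only [mul_zero] at h1
    exact h1.mono_left nhdsWithin_le_nhds
  exact ge_of_tendsto hlim (eventually_nhdsWithin_of_forall fun ε hε => key ε hε)

lemma density_zero (ν : Measure (Euc n)) [IsFiniteMeasure ν] (Γ : Set (Euc n))
    (hΓ : MeasurableSet Γ) (hν : ν Γ = 0) (t : ℝ) (ht : 0 ≤ t) :
    ∀ᵐ xb ∂(μH[t].restrict Γ), ∀ c : ℝ≥0∞, c ≠ 0 →
      ∀ᶠ ρ in 𝓝[>] (0:ℝ), ν (ball xb ρ) ≤ c * ENNReal.ofReal (ρ ^ t) := by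
  have h : ∀ m : ℕ, ∀ᵐ xb ∂(μH[t].restrict Γ),
      ∀ᶠ ρ in 𝓝[>] (0:ℝ), ν (ball xb ρ) ≤ ((m:ℝ≥0∞) + 1)⁻¹ * ENNReal.ofReal (ρ ^ t) := by
    intro m
    rw [ae_restrict_iff' hΓ, ae_iff]
    refine density_null ν Γ hν t ht (((m:ℝ≥0∞) + 1)⁻¹) (by simp) (by simp) _ ?_ ?_
    · intro x hx
      simp only [mem_ofPred_eq, Classical.not_imp] at hx
      exact hx.1
    · intro x hx
      simp only [mem_ofPred_eq, Classical.not_imp, not_eventually, not_le] at hx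
      exact hx.2
  filter_upwards [ae_all_iff.2 h] with x hx c hc
  obtain ⟨m, hm⟩ := ENNReal.exists_inv_nat_lt hc
  filter_upwards [hx m] with ρ hρ
  refine hρ.trans ?_
  gcongr
  refine le_trans ?_ hm.le
  rw [ENNReal.inv_le_inv]
  exact le_self_add

/-- `ν` as a measure. -/
def nuMeas (Ω : Set (Euc n)) (s : Euc n → ℝ) (p : ℝ) (u : Euc n → ℝ) : Measure (Euc n) :=
  (volume.restrict Ω).withDensity (fun x => ENNReal.ofReal (nuInt Ω s p u x))

lemma nuInt_nonneg (Ω : Set (Euc n)) (s : Euc n → ℝ) (p : ℝ) (u : Euc n → ℝ) (x : Euc n) :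
    0 ≤ nuInt Ω s p u x := by
  unfold nuInt
  exact mul_nonneg (Real.rpow_nonneg (Amean_nonneg Ω u x) _) (Real.rpow_nonneg (dB_nonneg Ω x) _)

lemma nuMeas_finite {Ω : Set (Euc n)} {s : Euc n → ℝ} {p : ℝ} {u : Euc n → ℝ}
    (hu : MemN Ω s p u) : IsFiniteMeasure (nuMeas Ω s p u) :=
  isFiniteMeasure_withDensity_ofReal hu.2.2

lemma nuMeas_ball {Ω : Set (Euc n)} {s : Euc n → ℝ} {p : ℝ} {u : Euc n → ℝ}
    (hu : MemN Ω s p u) {E : Set (Euc n)} (hE : MeasurableSet E) (hEΩ : E ⊆ Ω) :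
    ∫ x in E, nuInt Ω s p u x = (nuMeas Ω s p u E).toReal := by
  rw [nuMeas, withDensity_apply _ hE, Measure.restrict_restrict hE, inter_eq_left.2 hEΩ,
    integral_eq_lintegral_of_nonneg_ae (Eventually.of_forall fun x => nuInt_nonneg Ω s p u x)
      (hu.2.mono_set hEΩ).1]

lemma Amean_rpow {Ω : Set (Euc n)} (hΩ : IsOpen Ω) (hfr : (frontier Ω).Nonempty)
    (s : Euc n → ℝ) (p : ℝ) (u : Euc n → ℝ) {w : Euc n} (hw : w ∈ Ω) :
    Amean Ω u w ^ p = nuInt Ω s p u w * dB Ω w ^ (p * s w) := by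
  have hd := dB_pos hΩ hfr hw
  unfold nuInt
  rw [mul_assoc, ← Real.rpow_add hd]
  simp [Amean]

/-- constant of the one-step estimate -/
def Cst (n : ℕ) (p : ℝ) : ℝ :=
  (2 * 4 ^ n) ^ p * (2:ℝ) ^ ((n:ℝ) + p) * 6 ^ n / volume.real (ball (0 : Euc n) 1)

lemma Cst_pos (n : ℕ) (p : ℝ) : 0 < Cst n p := by
  have := vol_one_pos (n := n)
  unfold Cst
  positivity

lemma step_bound (hn : 1 ≤ n) {Ω : Set (Euc n)} (hΩ : IsOpen Ω) (hfr : (frontier Ω).Nonempty)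
    {s : Euc n → ℝ} {p : ℝ} (hp : 1 ≤ p) {u : Euc n → ℝ} (hu : MemN Ω s p u)
    {x y : Euc n} (hx : x ∈ Ω) (hxy : dist x y ≤ dB Ω x / 20)
    {s' B : ℝ} (hs' : 0 ≤ s') (hs'2 : p * s' ≤ n + p) (hB : 0 ≤ B)
    (hw : ∀ w ∈ ball x (dB Ω x / 6), dB Ω w ^ (p * s w) ≤ B * dB Ω w ^ (p * s')) :
    |gFun Ω u x - gFun Ω u y| ^ p ≤
      Cst n p * B * (nuMeas Ω s p u (ball x (dB Ω x / 6))).toReal * dB Ω x ^ (p * s' - n) := by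
  have hd := dB_pos hΩ hfr hx
  have hv := vol_one_pos (n := n)
  have hp0 : 0 ≤ p := by linarith
  have hsub : ball x (dB Ω x / 6) ⊆ Ω := ball_dB_subset hΩ hx (by linarith)
  set d := dB Ω x with hddef
  set v := volume.real (ball (0 : Euc n) 1) with hvdef
  set Kc : ℝ := (2 * 4 ^ n) ^ p * (B * (2 * d) ^ (p * s')) with hKc
  have hKc0 : 0 ≤ Kc := by positivity
  have hpt : ∀ w ∈ ball x (d / 6), |gFun Ω u x - gFun Ω u y| ^ p ≤ Kc * nuInt Ω s p u w := by
    intro w hwb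
    have h1 := g_sub_u_le hn hΩ hfr hu.1 (y := x) hx (by rw [dist_self]; linarith) hwb
    have h2 := g_sub_u_le hn hΩ hfr hu.1 hx hxy hwb
    have h3 : |gFun Ω u x - gFun Ω u y| ≤ 2 * 4 ^ n * Amean Ω u w := by
      have := abs_sub_le (gFun Ω u x) (u w) (gFun Ω u y)
      rw [abs_sub_comm (u w)] at this
      linarith
    have hA := Amean_nonneg Ω u w
    have hdw : dB Ω w ≤ 2 * d := by
      have h4 := dB_le_add Ω w x
      rw [mem_ball] at hwb
      linarith
    have h5 := hw w hwb
    have h6 : dB Ω w ^ (p * s') ≤ (2 * d) ^ (p * s') :=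
      Real.rpow_le_rpow (dB_nonneg Ω w) hdw (by positivity)
    calc |gFun Ω u x - gFun Ω u y| ^ p ≤ (2 * 4 ^ n * Amean Ω u w) ^ p :=
          Real.rpow_le_rpow (abs_nonneg _) h3 hp0
      _ = (2 * 4 ^ n) ^ p * (nuInt Ω s p u w * dB Ω w ^ (p * s w)) := by
          rw [Real.mul_rpow (by positivity) hA, Amean_rpow hΩ hfr s p u (hsub hwb)]
      _ ≤ (2 * 4 ^ n) ^ p * (nuInt Ω s p u w * (B * (2 * d) ^ (p * s'))) := by
          have hN := nuInt_nonneg Ω s p u w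
          gcongr
          exact h5.trans (by gcongr)
      _ = _ := by rw [hKc]; ring
  have hgbd : ∫ w in ball x (d / 6), |gFun Ω u x - gFun Ω u y| ^ p ≤
      ∫ w in ball x (d / 6), Kc * nuInt Ω s p u w :=
    setIntegral_mono_on (integrableOn_const measure_ball_lt_top.ne)
      ((hu.2.mono_set hsub).const_mul _) measurableSet_ball hpt
  rw [setIntegral_const, integral_const_mul, nuMeas_ball hu measurableSet_ball hsub, smul_eq_mul,
    vol_ball hn x (by positivity), ← hvdef] at hgbd
  set M := (nuMeas Ω s p u (ball x (d / 6))).toReal with hM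
  have hM0 : 0 ≤ M := ENNReal.toReal_nonneg
  have h7 : (2 * d) ^ (p * s') ≤ (2:ℝ) ^ ((n:ℝ) + p) * d ^ (p * s') := by
    rw [Real.mul_rpow (by norm_num) hd.le]
    gcongr
    norm_num
  have h8 : d ^ (p * s' - n) = d ^ (p * s') / d ^ n := by
    rw [Real.rpow_sub hd, Real.rpow_natCast]
  rw [h8]
  have h9 : |gFun Ω u x - gFun Ω u y| ^ p ≤ Kc * M / ((d / 6) ^ n * v) := by
    rw [le_div_iff₀ (by positivity), mul_comm]
    exact hgbd
  refine h9.trans ?_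
  calc Kc * M / ((d / 6) ^ n * v)
      ≤ ((2 * 4 ^ n) ^ p * (B * ((2:ℝ) ^ ((n:ℝ) + p) * d ^ (p * s')))) * M / ((d / 6) ^ n * v) := by
        rw [hKc]; gcongr
    _ = _ := by
        unfold Cst
        rw [div_pow, ← hvdef]
        field_simp

/-- constant of the connection estimate -/
def Ccon (n : ℕ) (p C b e : ℝ) : ℝ :=
  (22 * C) ^ p * (Cst n p * (4 * C) ^ (p * b) * e ^ (-((n:ℝ) + p)))

lemma Ccon_pos (n : ℕ) {p C b e : ℝ} (hC : 1 ≤ C) (he : 0 < e) : 0 < Ccon n p C b e := by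
  have := Cst_pos n p
  unfold Ccon
  positivity

lemma connect_bound (hn : 1 ≤ n) {Ω : Set (Euc n)} (hΩ : IsOpen Ω)
    {s : Euc n → ℝ} {p : ℝ} (hp : 1 ≤ p) {u : Euc n → ℝ} (hu : MemN Ω s p u)
    {z : Euc n} (hz : z ∈ frontier Ω) {C δ ρ θ e sl b α : ℝ} (hC : 1 ≤ C) (hδ1 : δ < 1)
    (hρ : 0 < ρ) (hρδ : 4 * C * ρ ≤ δ) (hθ : 1 ≤ θ) (he : 0 < e) (he1 : e ≤ 1)
    (hsl0 : 0 ≤ sl) (hslb : sl ≤ b)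
    (hsl : ∀ w ∈ Ω ∩ ball z δ, sl ≤ s w) (hα : α ≤ alphaFun n p sl θ)
    (γ : ℝ → Euc n) (hγ : ContinuousOn γ (Icc 0 1)) (h0 : dist (γ 0) z < ρ)
    (hγE : ∀ τ ∈ Icc (0:ℝ) 1, γ τ ∈ Ω ∧ e * ρ ^ θ ≤ dB Ω (γ τ))
    (hV : eVariationOn γ (Icc 0 1) ≤ ENNReal.ofReal (C * ρ)) :
    |gFun Ω u (γ 0) - gFun Ω u (γ 1)| ^ p ≤
      Ccon n p C b e * ρ ^ α * (nuMeas Ω s p u (ball z (4 * C * ρ))).toReal := by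
  have hfr : (frontier Ω).Nonempty := ⟨z, hz⟩
  have := nuMeas_finite hu
  have hp0 : 0 < p := by linarith
  have hCρ : ρ ≤ C * ρ := by nlinarith
  set R := 4 * C * ρ with hR
  have hR0 : 0 < R := by positivity
  set M := (nuMeas Ω s p u (ball z R)).toReal with hM
  have hM0 : 0 ≤ M := ENNReal.toReal_nonneg
  set r0 := e * ρ ^ θ with hr0
  have hr0pos : 0 < r0 := by positivity
  set s' := min sl (((n:ℝ) + p - 1) / p) with hs'
  have hs'0 : 0 ≤ s' := le_min hsl0 (by
    apply div_nonneg _ hp0.le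
    have : (0:ℝ) ≤ n := Nat.cast_nonneg n
    linarith)
  have hs'sl : s' ≤ sl := min_le_left _ _
  have hs'2 : p * s' ≤ n + p - 1 := by
    have : s' ≤ ((n:ℝ) + p - 1) / p := min_le_right _ _
    rw [le_div_iff₀ hp0] at this
    linarith
  have hexp : p + θ * (p * s' - n - p) + p * (sl - s') = alphaFun n p sl θ := by
    unfold alphaFun
    split_ifs with h
    · have : s' = sl := min_eq_left (by rw [le_div_iff₀ hp0]; linarith)
      rw [this]; ring
    · have : s' = ((n:ℝ) + p - 1) / p := min_eq_right (by rw [div_le_iff₀ hp0]; linarith)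
      have : p * s' = (n:ℝ) + p - 1 := by rw [this]; field_simp
      linear_combination (θ - 1) * this
  set B := R ^ (p * (sl - s')) with hB
  have hB0 : 0 ≤ B := by positivity
  have hCst := Cst_pos n p
  set K := (Cst n p * B * M * r0 ^ (p * s' - n - p)) ^ (1 / p) with hK
  have hK0 : 0 ≤ K := by positivity
  have hKp : K ^ p = Cst n p * B * M * r0 ^ (p * s' - n - p) := by
    rw [hK, ← Real.rpow_mul (by positivity), one_div, inv_mul_cancel₀ hp0.ne', Real.rpow_one]
  have hdist : ∀ τ ∈ Icc (0:ℝ) 1, dist (γ τ) z < 2 * C * ρ := by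
    intro τ hτ
    have h1 := (eVariationOn.edist_le γ (s := Icc 0 1) hτ (⟨le_rfl, zero_le_one⟩)).trans hV
    rw [edist_dist, ENNReal.ofReal_le_ofReal_iff (by positivity)] at h1
    have := dist_triangle (γ τ) (γ 0) z
    linarith
  have hstep : ∀ τ ∈ Icc (0:ℝ) 1, ∀ τ' ∈ Icc (0:ℝ) 1,
      dist (γ τ) (γ τ') ≤ (1 / 20) * dB Ω (γ τ) →
      |gFun Ω u (γ τ) - gFun Ω u (γ τ')| ≤ K * dB Ω (γ τ) := by
    intro τ hτ τ' hτ' hd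
    have hτΩ := (hγE τ hτ).1
    have hdz := hdist τ hτ
    have hdd := dB_le_dist (x := γ τ) hz
    have hdpos := dB_pos hΩ hfr hτΩ
    have hballΩ : ball (γ τ) (dB Ω (γ τ) / 6) ⊆ Ω := ball_dB_subset hΩ hτΩ (by linarith)
    have hballR : ball (γ τ) (dB Ω (γ τ) / 6) ⊆ ball z R := by
      apply ball_subset_ball'
      linarith
    have h1 := step_bound hn hΩ hfr hp hu (x := γ τ) (y := γ τ') hτΩ (by linarith) (s' := s')
      (B := B) hs'0 (by linarith) hB0 (by
        intro w hw
        have hwΩ := hballΩ hw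
        have hwR := hballR hw
        have hdw := dB_pos hΩ hfr hwΩ
        have hdwR : dB Ω w ≤ R := (dB_le_dist hz).trans (mem_ball.1 hwR).le
        have hsw := hsl w ⟨hwΩ, ball_subset_ball hρδ hwR⟩
        calc dB Ω w ^ (p * s w) ≤ dB Ω w ^ (p * sl) :=
              Real.rpow_le_rpow_of_exponent_ge hdw (by linarith) (by gcongr)
          _ = dB Ω w ^ (p * (sl - s')) * dB Ω w ^ (p * s') := by
              rw [← Real.rpow_add hdw]; congr 1; ring
          _ ≤ B * dB Ω w ^ (p * s') := by
              rw [hB]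
              gcongr)
    have h2 : (nuMeas Ω s p u (ball (γ τ) (dB Ω (γ τ) / 6))).toReal ≤ M :=
      ENNReal.toReal_mono (measure_ne_top _ _) (measure_mono hballR)
    have h3 : dB Ω (γ τ) ^ (p * s' - n) ≤ r0 ^ (p * s' - n - p) * dB Ω (γ τ) ^ p := by
      have : p * s' - n = (p * s' - n - p) + p := by ring
      rw [this, Real.rpow_add hdpos]
      gcongr
      · rw [← this]
        exact Real.rpow_le_rpow_of_nonpos hr0pos (hγE τ hτ).2 (by linarith)
    have h4 : |gFun Ω u (γ τ) - gFun Ω u (γ τ')| ^ p ≤ (K * dB Ω (γ τ)) ^ p := by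
      rw [Real.mul_rpow hK0 hdpos.le, hKp]
      refine h1.trans ?_
      calc _ ≤ Cst n p * B * M * (r0 ^ (p * s' - n - p) * dB Ω (γ τ) ^ p) := by gcongr
        _ = _ := by ring
    exact (Real.rpow_le_rpow_iff (abs_nonneg _) (by positivity) hp0).1 h4
  have hch := chain_bound γ (gFun Ω u) (dB Ω) K (1 / 20) r0 (2 * C * ρ) (C * ρ) hγ hr0pos
    (by norm_num) hK0 (fun τ hτ => (hγE τ hτ).2)
    (fun τ hτ => (dB_le_dist hz).trans (hdist τ hτ).le) hstep hV (by positivity)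
  have hch2 : |gFun Ω u (γ 0) - gFun Ω u (γ 1)| ≤ (22 * C * ρ) * K := by
    refine hch.trans (le_of_eq ?_)
    ring
  have hρ1 : ρ ≤ 1 := by nlinarith
  calc |gFun Ω u (γ 0) - gFun Ω u (γ 1)| ^ p ≤ ((22 * C * ρ) * K) ^ p :=
        Real.rpow_le_rpow (abs_nonneg _) hch2 hp0.le
    _ = (22 * C) ^ p * ρ ^ p * (Cst n p * B * M * r0 ^ (p * s' - n - p)) := by
        rw [Real.mul_rpow (by positivity) hK0, hKp, Real.mul_rpow (by positivity) hρ.le]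
    _ = (22 * C) ^ p * (Cst n p * (4 * C) ^ (p * (sl - s')) * e ^ (p * s' - n - p)) *
          (ρ ^ p * ρ ^ (θ * (p * s' - n - p)) * ρ ^ (p * (sl - s'))) * M := by
        rw [hB, hR, hr0, Real.mul_rpow (by positivity) hρ.le,
          Real.mul_rpow he.le (by positivity), ← Real.rpow_mul hρ.le]
        ring
    _ = (22 * C) ^ p * (Cst n p * (4 * C) ^ (p * (sl - s')) * e ^ (p * s' - n - p)) *
          ρ ^ (alphaFun n p sl θ) * M := by
        rw [← Real.rpow_add hρ, ← Real.rpow_add hρ, hexp]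
    _ ≤ _ := by
        unfold Ccon
        have e1 : (4 * C) ^ (p * (sl - s')) ≤ (4 * C) ^ (p * b) :=
          Real.rpow_le_rpow_of_exponent_le (by linarith) (by gcongr; linarith)
        have e2 : e ^ (p * s' - n - p) ≤ e ^ (-((n:ℝ) + p)) :=
          Real.rpow_le_rpow_of_exponent_ge he he1 (by
            have : 0 ≤ p * s' := by positivity
            linarith)
        have e3 : ρ ^ (alphaFun n p sl θ) ≤ ρ ^ α :=
          Real.rpow_le_rpow_of_exponent_ge hρ hρ1 hα
        gcongr

lemma scale_chain {Ω : Set (Euc n)} (hΩ : IsOpen Ω) (hfr : (frontier Ω).Nonempty)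
    {g : Euc n → ℝ} {ν : Measure (Euc n)} [IsFiniteMeasure ν] {θ : Euc n → ℝ}
    (hθ : ∀ z, 1 ≤ θ z)
    {p C K α η ρ1 : ℝ} (hp : 1 ≤ p) (hC : 1 ≤ C) (hη : 0 < η) (hη1 : η < 1)
    (hρ1 : ρ1 ≤ 1)
    (hcon : ∀ z ∈ frontier Ω, ∀ ρ : ℝ, 0 < ρ → ρ ≤ ρ1 → ∀ x ∈ Ω ∩ ball z ρ, ∀ x' ∈ Ω ∩ ball z ρ,
      (η / 8 * ρ) ^ θ z ≤ dB Ω x → (η / 8 * ρ) ^ θ z ≤ dB Ω x' →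
      |g x - g x'| ^ p ≤ K * ρ ^ α * (ν (ball z (4 * C * ρ))).toReal)
    (hcork : ∀ z ∈ frontier Ω, ∀ δ : ℝ, 0 < δ → δ ≤ ρ1 →
      ∃ x ∈ Ω, dist z x < δ ∧ (η * δ) ^ θ z < dB Ω x) (hK : 0 ≤ K)
    {xb c : Euc n} (hxb : xb ∈ frontier Ω) {ρ : ℝ} (hρ : 0 < ρ) (hρρ : 8 * ρ ≤ ρ1)
    (hcΩ : c ∈ Ω) (hc : dist xb c < ρ) (hcd : (η * ρ) ^ θ xb < dB Ω c)
    {x : Euc n} (hx : x ∈ Ω) (hxρ : x ∈ ball xb ρ) :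
    ∃ m : ℕ, |g x - g c| ≤ 2 * ∑ j ∈ Finset.range m,
      (K * (8 * ρ * (1 / 2) ^ j) ^ α *
        (ν (ball x (5 * C * (8 * ρ * (1 / 2) ^ j)))).toReal) ^ (1 / p) := by
  have hp0 : 0 < p := by linarith
  set R : ℕ → ℝ := fun j => 8 * ρ * (1 / 2) ^ j with hR
  have hR0 : ∀ j, 0 < R j := fun j => by simp only [hR]; positivity
  have hRs : ∀ j, R (j + 1) = R j / 2 := fun j => by simp only [hR, pow_succ]; ring
  have hRz : R 0 = 8 * ρ := by simp [hR]
  have hRanti : Antitone R := antitone_nat_of_succ_le fun j => by rw [hRs]; linarith [hR0 j]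
  have hRle : ∀ j, R j ≤ ρ1 := fun j => (hRanti (Nat.zero_le j)).trans (by rw [hRz]; exact hρρ)
  set T : ℕ → ℝ := fun j => (K * R j ^ α * (ν (ball x (5 * C * R j))).toReal) ^ (1 / p) with hT
  have hT0 : ∀ j, 0 ≤ T j := fun j => by
    have := hR0 j
    simp only [hT]; positivity
  have hTle : ∀ j (y a b : Euc n), dist y x ≤ R j →
      |g a - g b| ^ p ≤ K * R j ^ α * (ν (ball y (4 * C * R j))).toReal → |g a - g b| ≤ T j := by
    intro j y a b hy hab
    have hRj := hR0 j
    have h1 : (ν (ball y (4 * C * R j))).toReal ≤ (ν (ball x (5 * C * R j))).toReal := by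
      refine ENNReal.toReal_mono (measure_ne_top _ _) (measure_mono ?_)
      apply ball_subset_ball'
      nlinarith
    have h2 : |g a - g b| ^ p ≤ K * R j ^ α * (ν (ball x (5 * C * R j))).toReal :=
      hab.trans (by gcongr)
    have h3 := Real.rpow_le_rpow (by positivity) h2 (by positivity : 0 ≤ 1 / p)
    rwa [← Real.rpow_mul (abs_nonneg _), mul_one_div_cancel hp0.ne', Real.rpow_one] at h3
  have hxpos := dB_pos hΩ hfr hx
  obtain ⟨z, hz, hzd⟩ := isClosed_frontier.exists_infDist_eq_dist hfr x
  change dB Ω x = dist x z at hzd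
  rw [mem_ball] at hxρ
  have hrρ : dist x z < ρ := by
    rw [← hzd]; exact (dB_le_dist hxb).trans_lt hxρ
  -- monotonicity of powers
  have hpow : ∀ a b y y' : ℝ, 0 < a → a ≤ b → b ≤ 1 → y' ≤ y → 0 ≤ y' → a ^ y ≤ b ^ y' := by
    intro a b y y' ha hab hb hy hy'
    exact (Real.rpow_le_rpow_of_exponent_ge ha (hab.trans hb) hy).trans
      (Real.rpow_le_rpow ha.le hab hy')
  -- the scale of x
  have hex : ∃ j, R (j + 1) ≤ dB Ω x := by
    have h1 : Tendsto (fun j : ℕ => 8 * ρ * (1 / 2 : ℝ) ^ j) atTop (𝓝 (8 * ρ * 0)) :=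
      (tendsto_pow_atTop_nhds_zero_of_lt_one (by norm_num) (by norm_num)).const_mul _
    rw [mul_zero] at h1
    have h2 := (h1.comp (tendsto_add_atTop_nat 1)).eventually (gt_mem_nhds hxpos)
    obtain ⟨j, hj⟩ := h2.exists
    exact ⟨j, hj.le⟩
  obtain ⟨J, hJ1, hJ2⟩ : ∃ J, R (J + 1) ≤ dB Ω x ∧ dB Ω x < R J := by
    classical
    refine ⟨Nat.find hex, Nat.find_spec hex, ?_⟩
    rcases Nat.eq_zero_or_pos (Nat.find hex) with h0 | h0
    · rw [h0, hRz]; linarith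
    · have := Nat.find_min hex (Nat.sub_lt h0 one_pos)
      rw [Nat.sub_one_add_one h0.ne'] at this
      exact not_le.1 this
  choose cj hcjΩ hcjd hcjb using fun j : ℕ =>
    hcork z hz (R j / 2) (by linarith [hR0 j]) (by linarith [hRle j, hR0 j])
  have hθz : 0 ≤ θ z := zero_le_one.trans (hθ z)
  have hcj1 : ∀ j, cj j ∈ Ω ∩ ball z (R j) := fun j =>
    ⟨hcjΩ j, by rw [mem_ball, dist_comm]; linarith [hcjd j, hR0 j]⟩
  have hcj2 : ∀ j, (η / 8 * R j) ^ θ z ≤ dB Ω (cj j) := fun j => by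
    refine le_trans ?_ (hcjb j).le
    have := hR0 j
    apply Real.rpow_le_rpow (by positivity) _ hθz
    nlinarith
  have hzx : ∀ j ≤ J, dist z x ≤ R j := fun j hj => by
    rw [dist_comm, ← hzd]; exact hJ2.le.trans (hRanti hj)
  have hA : |g x - g (cj J)| ≤ T J := by
    refine hTle J z x (cj J) (hzx J le_rfl) (hcon z hz (R J) (hR0 J) (hRle J) x
      ⟨hx, by rw [mem_ball, ← hzd]; exact hJ2⟩ (cj J) (hcj1 J) ?_ (hcj2 J))
    rw [hRs] at hJ1
    have h1 := hR0 J
    have h2 := hRle J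
    calc (η / 8 * R J) ^ θ z ≤ (R J / 2) ^ (1:ℝ) :=
          hpow _ _ _ _ (by positivity) (by nlinarith) (by linarith) (hθ z) zero_le_one
      _ ≤ dB Ω x := by rw [Real.rpow_one]; exact hJ1
  have hB : ∀ j < J, |g (cj j) - g (cj (j + 1))| ≤ T j := by
    intro j hj
    have h1 := hR0 j
    refine hTle j z _ _ (hzx j hj.le) (hcon z hz (R j) h1 (hRle j) _ (hcj1 j) _
      ⟨hcjΩ _, ?_⟩ (hcj2 j) ?_)
    · exact ball_subset_ball (hRanti (Nat.le_succ j)) (hcj1 (j + 1)).2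
    · refine le_trans ?_ (hcjb (j + 1)).le
      rw [hRs]
      apply Real.rpow_le_rpow (by positivity) _ hθz
      nlinarith
  have hcz : dist c z < 3 * ρ := by
    have h1 := dist_triangle4 c xb x z
    rw [dist_comm c xb, dist_comm xb x] at h1
    linarith
  have hC0 : |g (cj 0) - g c| ≤ T 0 := by
    have hcz0 := hcjd 0
    have hcb0 := hcjb 0
    rw [hRz] at hcz0 hcb0
    rcases le_total (θ xb) (θ z) with hle | hle
    · refine hTle 0 z _ _ (hzx 0 (Nat.zero_le _)) (hcon z hz (R 0) (hR0 0) (hRle 0) _ (hcj1 0) _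
        ⟨hcΩ, by rw [mem_ball, hRz]; linarith⟩ (hcj2 0) ?_)
      refine le_trans ?_ hcd.le
      rw [hRz]
      exact hpow _ _ _ _ (by positivity) (by linarith) (by nlinarith) hle
        (zero_le_one.trans (hθ xb))
    · refine hTle 0 xb _ _ (by rw [hRz, dist_comm]; linarith) (hcon xb hxb (R 0) (hR0 0) (hRle 0) _
        ⟨hcjΩ 0, ?_⟩ _ ⟨hcΩ, by rw [mem_ball, hRz, dist_comm]; linarith⟩ ?_ ?_)
      · rw [mem_ball, hRz]
        have h1 := dist_triangle4 (cj 0) z x xb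
        rw [dist_comm (cj 0) z, dist_comm z x] at h1
        linarith
      · refine le_trans ?_ hcb0.le
        rw [hRz]
        exact hpow _ _ _ _ (by positivity) (by nlinarith) (by nlinarith) hle hθz
      · refine le_trans (le_of_eq ?_) hcd.le
        rw [hRz]; congr 1; ring
  have hD : dist (g (cj 0)) (g (cj J)) ≤ ∑ j ∈ Finset.range J, T j :=
    dist_le_range_sum_of_dist_le (f := fun j => g (cj j)) J (fun {j} hj => by
      rw [Real.dist_eq]; exact hB j hj)
  rw [Real.dist_eq, abs_sub_comm] at hD
  refine ⟨J + 1, ?_⟩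
  change |g x - g c| ≤ 2 * ∑ j ∈ Finset.range (J + 1), T j
  have h1 := abs_sub_le (g x) (g (cj J)) (g c)
  have h2 := abs_sub_le (g (cj J)) (g (cj 0)) (g c)
  have h3 : T 0 ≤ ∑ j ∈ Finset.range (J + 1), T j :=
    Finset.single_le_sum (fun j _ => hT0 j) (Finset.mem_range.2 (Nat.succ_pos J))
  have h4 := Finset.sum_range_succ T J
  have h5 : 0 ≤ ∑ j ∈ Finset.range J, T j := Finset.sum_nonneg fun j _ => hT0 j
  linarith

lemma weighted_sum_rpow (a : ℕ → ℝ) (ha : ∀ j, 0 ≤ a j) {p q : ℝ} (hp : 1 ≤ p) (hq : 0 < q)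
    (hq1 : q < 1) (m : ℕ) :
    (∑ j ∈ Finset.range m, a j) ^ p ≤
      ((1 - q)⁻¹) ^ p * ∑ j ∈ Finset.range m, (a j / q ^ j) ^ p := by
  have hp0 : 0 < p := by linarith
  set X := ∑ j ∈ Finset.range m, (a j / q ^ j) ^ p with hX
  have hterm : ∀ j, 0 ≤ (a j / q ^ j) ^ p := fun j => by have := ha j; positivity
  have hX0 : 0 ≤ X := Finset.sum_nonneg fun j _ => hterm j
  have h1 : ∀ j ∈ Finset.range m, a j ≤ X ^ (1 / p) * q ^ j := by
    intro j hj
    have h2 : (a j / q ^ j) ^ p ≤ X := Finset.single_le_sum (fun j _ => hterm j) hj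
    have h3 := Real.rpow_le_rpow (hterm j) h2 (by positivity : 0 ≤ 1 / p)
    rw [← Real.rpow_mul (by have := ha j; positivity), mul_one_div_cancel hp0.ne',
      Real.rpow_one, div_le_iff₀ (by positivity)] at h3
    exact h3
  have h4 : ∑ j ∈ Finset.range m, a j ≤ X ^ (1 / p) * (1 - q)⁻¹ := by
    refine (Finset.sum_le_sum h1).trans ?_
    rw [← Finset.mul_sum]
    gcongr
    rw [← tsum_geometric_of_lt_one hq.le hq1]
    exact (summable_geometric_of_lt_one hq.le hq1).sum_le_tsum _ (fun _ _ => by positivity)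
  have h5 : 0 < (1 - q)⁻¹ := inv_pos.2 (by linarith)
  refine (Real.rpow_le_rpow (Finset.sum_nonneg fun j _ => ha j) h4 hp0.le).trans ?_
  rw [Real.mul_rpow (by positivity) h5.le, ← Real.rpow_mul hX0, one_div_mul_cancel hp0.ne',
    Real.rpow_one, mul_comm]

lemma measurable_ball_measure (ν : Measure (Euc n)) [IsFiniteMeasure ν] (R : ℝ) :
    Measurable fun x => ν (ball x R) := by
  have hS : MeasurableSet {q : Euc n × Euc n | dist q.2 q.1 < R} :=
    (isOpen_lt (continuous_snd.dist continuous_fst) continuous_const).measurableSet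
  exact measurable_measure_prodMk_left (ν := ν) hS

lemma lintegral_ball_measure (ν : Measure (Euc n)) [IsFiniteMeasure ν] (xb : Euc n) (ρ R : ℝ) :
    ∫⁻ x in ball xb ρ, ν (ball x R) ≤ volume (ball (0 : Euc n) R) * ν (ball xb (ρ + R)) := by
  have hS : MeasurableSet {q : Euc n × Euc n | q.1 ∈ ball xb ρ ∧ dist q.2 q.1 < R} :=
    ((isOpen_ball.preimage continuous_fst).inter
      (isOpen_lt (continuous_snd.dist continuous_fst) continuous_const)).measurableSet
  set S := {q : Euc n × Euc n | q.1 ∈ ball xb ρ ∧ dist q.2 q.1 < R} with hSdef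
  have h1 : ∫⁻ x in ball xb ρ, ν (ball x R) ≤ (volume.prod ν) S := by
    rw [Measure.prod_apply hS, ← lintegral_indicator measurableSet_ball]
    refine lintegral_mono fun x => ?_
    by_cases hx : x ∈ ball xb ρ
    · rw [indicator_of_mem hx]
      refine measure_mono fun y hy => ?_
      exact ⟨hx, hy⟩
    · rw [indicator_of_notMem hx]; exact zero_le
  refine h1.trans ?_
  rw [Measure.prod_apply_symm hS]
  have h2 : ∀ y, volume ((fun x => (x, y)) ⁻¹' S) ≤
      (ball xb (ρ + R)).indicator (fun _ => volume (ball (0 : Euc n) R)) y := by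
    intro y
    by_cases hy : y ∈ ball xb (ρ + R)
    · rw [indicator_of_mem hy, ← Measure.addHaar_ball_center volume y R]
      refine measure_mono fun x hx => ?_
      rw [mem_ball, dist_comm]; exact hx.2
    · rw [indicator_of_notMem hy, nonpos_iff_eq_zero]
      have : (fun x => (x, y)) ⁻¹' S = ∅ := by
        ext x
        simp only [mem_preimage, mem_empty_iff_false, iff_false]
        intro hx
        apply hy
        have h3 := mem_ball.1 hx.1
        have h4 : dist y x < R := hx.2
        rw [mem_ball]
        have := dist_triangle y x xb
        linarith
      rw [this, measure_empty]
  refine (lintegral_mono h2).trans ?_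
  rw [lintegral_indicator measurableSet_ball, setLIntegral_const]

lemma g_int (hn : 1 ≤ n) {Ω : Set (Euc n)} (hΩ : IsOpen Ω) (hfr : (frontier Ω).Nonempty)
    {g : Euc n → ℝ} {ν : Measure (Euc n)} [IsFiniteMeasure ν] {θ : Euc n → ℝ}
    (hθ : ∀ z, 1 ≤ θ z)
    {p C K α η ρ1 : ℝ} (hp : 1 ≤ p) (hC : 1 ≤ C) (hη : 0 < η) (hη1 : η < 1)
    (hρ1 : ρ1 ≤ 1)
    (hcon : ∀ z ∈ frontier Ω, ∀ ρ : ℝ, 0 < ρ → ρ ≤ ρ1 → ∀ x ∈ Ω ∩ ball z ρ, ∀ x' ∈ Ω ∩ ball z ρ,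
      (η / 8 * ρ) ^ θ z ≤ dB Ω x → (η / 8 * ρ) ^ θ z ≤ dB Ω x' →
      |g x - g x'| ^ p ≤ K * ρ ^ α * (ν (ball z (4 * C * ρ))).toReal)
    (hcork : ∀ z ∈ frontier Ω, ∀ δ : ℝ, 0 < δ → δ ≤ ρ1 →
      ∃ x ∈ Ω, dist z x < δ ∧ (η * δ) ^ θ z < dB Ω x) (hK : 0 ≤ K) (hα : 0 < α + n) :
    ∃ Kt : ℝ, 0 ≤ Kt ∧ ∀ xb ∈ frontier Ω, ∀ ρ : ℝ, 0 < ρ → 8 * ρ ≤ ρ1 → ∀ c ∈ Ω,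
      dist xb c < ρ → (η * ρ) ^ θ xb < dB Ω c →
      ∫⁻ x in Ω ∩ ball xb ρ, ENNReal.ofReal (|g x - g c| ^ p) ≤
        ENNReal.ofReal (Kt * ρ ^ (α + n)) * ν (ball xb (41 * C * ρ)) := by
  have hp0 : 0 < p := by linarith
  set β := α + n with hβ
  set q : ℝ := (1 / 2) ^ (β / (2 * p)) with hq
  set κ : ℝ := (1 / 2) ^ (β / 2) with hκ
  have hq0 : 0 < q := by positivity
  have hκ0 : 0 < κ := by positivity
  have hq1 : q < 1 := Real.rpow_lt_one (by norm_num) (by norm_num) (by positivity)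
  have hκ1 : κ < 1 := Real.rpow_lt_one (by norm_num) (by norm_num) (by positivity)
  have hqκ : q ^ p = κ := by
    rw [hq, ← Real.rpow_mul (by norm_num)]; congr 1; field_simp
  have hκκ : κ * κ = (1 / 2 : ℝ) ^ β := by
    rw [hκ, ← Real.rpow_add (by norm_num)]; congr 1; ring
  have h1q : 0 < (1 - q)⁻¹ := inv_pos.2 (by linarith)
  have h1κ : 0 < (1 - κ)⁻¹ := inv_pos.2 (by linarith)
  have hv := vol_one_pos (n := n)
  set v := volume.real (ball (0 : Euc n) 1) with hvdef
  set E : ℝ := 2 ^ p * (1 - q)⁻¹ ^ p * K * (5 * C) ^ n * v * 8 ^ β with hE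
  have hE0 : 0 ≤ E := by positivity
  refine ⟨E * (1 - κ)⁻¹, by positivity, ?_⟩
  intro xb hxb ρ hρ hρρ c hcΩ hc hcd
  set R : ℕ → ℝ := fun j => 8 * ρ * (1 / 2) ^ j with hR
  have hR0 : ∀ j, 0 < R j := fun j => by simp only [hR]; positivity
  have hRle : ∀ j, R j ≤ 8 * ρ := fun j => by
    simp only [hR]
    exact mul_le_of_le_one_right (by positivity) (pow_le_one₀ (by norm_num) (by norm_num))
  set coef : ℕ → ℝ := fun j => 2 ^ p * (1 - q)⁻¹ ^ p * (K * R j ^ α / κ ^ j) with hcoef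
  have hcoef0 : ∀ j, 0 ≤ coef j := fun j => by
    have := hR0 j
    simp only [hcoef]; positivity
  have hqj : ∀ j : ℕ, (q ^ j) ^ p = κ ^ j := fun j => by
    rw [← hqκ, ← Real.rpow_natCast q j, ← Real.rpow_mul hq0.le, mul_comm, Real.rpow_mul hq0.le,
      Real.rpow_natCast]
  have hpt : ∀ x ∈ Ω ∩ ball xb ρ, ENNReal.ofReal (|g x - g c| ^ p) ≤
      ∑' j, ENNReal.ofReal (coef j) * ν (ball x (5 * C * R j)) := by
    rintro x ⟨hx, hxρ⟩
    obtain ⟨m, hm⟩ := scale_chain hΩ hfr hθ hp hC hη hη1 hρ1 hcon hcork hK hxb hρ hρρ hcΩ hc hcd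
      hx hxρ
    set T : ℕ → ℝ := fun j => (K * R j ^ α * (ν (ball x (5 * C * R j))).toReal) ^ (1 / p) with hT
    change |g x - g c| ≤ 2 * ∑ j ∈ Finset.range m, T j at hm
    have hb0 : ∀ j, 0 ≤ K * R j ^ α * (ν (ball x (5 * C * R j))).toReal := fun j => by
      have := hR0 j
      positivity
    have hT0 : ∀ j, 0 ≤ T j := fun j => Real.rpow_nonneg (hb0 j) _
    have hsum0 : 0 ≤ ∑ j ∈ Finset.range m, T j := Finset.sum_nonneg fun j _ => hT0 j
    have h1 : |g x - g c| ^ p ≤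
        ∑ j ∈ Finset.range m, coef j * (ν (ball x (5 * C * R j))).toReal := by
      calc |g x - g c| ^ p ≤ (2 * ∑ j ∈ Finset.range m, T j) ^ p :=
            Real.rpow_le_rpow (abs_nonneg _) hm hp0.le
        _ = 2 ^ p * (∑ j ∈ Finset.range m, T j) ^ p := Real.mul_rpow (by norm_num) hsum0
        _ ≤ 2 ^ p * ((1 - q)⁻¹ ^ p * ∑ j ∈ Finset.range m, (T j / q ^ j) ^ p) := by
            gcongr
            exact weighted_sum_rpow T hT0 hp hq0 hq1 m
        _ = _ := by
            rw [← mul_assoc, Finset.mul_sum]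
            refine Finset.sum_congr rfl fun j _ => ?_
            rw [Real.div_rpow (hT0 j) (by positivity), hqj]
            simp only [hT, hcoef]
            rw [← Real.rpow_mul (hb0 j), one_div_mul_cancel hp0.ne', Real.rpow_one]
            ring
    refine (ENNReal.ofReal_le_ofReal h1).trans ?_
    rw [ENNReal.ofReal_sum_of_nonneg fun j _ => mul_nonneg (hcoef0 j) ENNReal.toReal_nonneg]
    refine le_trans (Finset.sum_le_sum fun j _ => ?_) (ENNReal.sum_le_tsum (Finset.range m))
    rw [ENNReal.ofReal_mul (hcoef0 j), ENNReal.ofReal_toReal (measure_ne_top _ _)]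
  have hmeas : MeasurableSet (Ω ∩ ball xb ρ) := hΩ.measurableSet.inter measurableSet_ball
  calc ∫⁻ x in Ω ∩ ball xb ρ, ENNReal.ofReal (|g x - g c| ^ p)
      ≤ ∫⁻ x in Ω ∩ ball xb ρ, ∑' j, ENNReal.ofReal (coef j) * ν (ball x (5 * C * R j)) :=
        setLIntegral_mono' hmeas hpt
    _ ≤ ∫⁻ x in ball xb ρ, ∑' j, ENNReal.ofReal (coef j) * ν (ball x (5 * C * R j)) :=
        lintegral_mono_set inter_subset_right
    _ = ∑' j, ENNReal.ofReal (coef j) * ∫⁻ x in ball xb ρ, ν (ball x (5 * C * R j)) := by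
        rw [lintegral_tsum fun j => ((measurable_ball_measure ν _).const_mul _).aemeasurable]
        refine tsum_congr fun j => ?_
        rw [lintegral_const_mul _ (measurable_ball_measure ν _)]
    _ ≤ ∑' j, ENNReal.ofReal (E * ρ ^ β * κ ^ j) * ν (ball xb (41 * C * ρ)) := by
        refine ENNReal.tsum_le_tsum fun j => ?_
        have hRj := hR0 j
        have h1 := lintegral_ball_measure ν xb ρ (5 * C * R j)
        have h2 : ν (ball xb (ρ + 5 * C * R j)) ≤ ν (ball xb (41 * C * ρ)) := by
          refine measure_mono (ball_subset_ball ?_)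
          have := mul_le_mul_of_nonneg_left (hRle j) (by positivity : 0 ≤ 5 * C)
          nlinarith
        have h3 : volume (ball (0 : Euc n) (5 * C * R j)) =
            ENNReal.ofReal ((5 * C * R j) ^ n * v) := by
          rw [hvdef, ← vol_ball hn 0 (by positivity), Measure.real,
            ENNReal.ofReal_toReal measure_ball_lt_top.ne]
        have h4 : coef j * ((5 * C * R j) ^ n * v) = E * ρ ^ β * κ ^ j := by
          have e1 : R j ^ α * R j ^ n = (8 ^ β * ρ ^ β) * (κ ^ j * κ ^ j) := by
            rw [← Real.rpow_natCast (R j) n, ← Real.rpow_add hRj, ← hβ]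
            simp only [hR]
            rw [Real.mul_rpow (by positivity) (by positivity), Real.mul_rpow (by norm_num) hρ.le,
              ← mul_pow, hκκ, ← Real.rpow_natCast (1 / 2 : ℝ) j, ← Real.rpow_mul (by norm_num),
              mul_comm (j : ℝ), Real.rpow_mul (by norm_num), Real.rpow_natCast]
          have e2 : coef j * ((5 * C * R j) ^ n * v) =
              2 ^ p * (1 - q)⁻¹ ^ p * K * (5 * C) ^ n * v * (R j ^ α * R j ^ n) / κ ^ j := by
            simp only [hcoef]; rw [mul_pow (5 * C) (R j)]; ring
          rw [e2, e1, hE]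
          field_simp
        calc _ ≤ ENNReal.ofReal (coef j) * (volume (ball (0 : Euc n) (5 * C * R j)) *
              ν (ball xb (ρ + 5 * C * R j))) := by gcongr
          _ ≤ ENNReal.ofReal (coef j) * (ENNReal.ofReal ((5 * C * R j) ^ n * v) *
              ν (ball xb (41 * C * ρ))) := by rw [h3]; gcongr
          _ = _ := by rw [← mul_assoc, ← ENNReal.ofReal_mul (hcoef0 j), h4]
    _ = ENNReal.ofReal (E * (1 - κ)⁻¹ * ρ ^ β) * ν (ball xb (41 * C * ρ)) := by
        rw [ENNReal.tsum_mul_right]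
        congr 1
        rw [← ENNReal.ofReal_tsum_of_nonneg (fun j => by positivity)
          ((summable_geometric_of_lt_one hκ0.le hκ1).mul_left _), tsum_mul_left,
          tsum_geometric_of_lt_one hκ0.le hκ1]
        congr 1; ring

lemma three_rpow {a b c p : ℝ} (ha : 0 ≤ a) (hb : 0 ≤ b) (hc : 0 ≤ c) (hp : 1 ≤ p) :
    (a + b + c) ^ p ≤ 3 ^ p * (a ^ p + b ^ p + c ^ p) := by
  have hp0 : 0 ≤ p := by linarith
  have key : ∀ m : ℝ, 0 ≤ m → a ≤ m → b ≤ m → c ≤ m → m ^ p ≤ a ^ p + b ^ p + c ^ p →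
      (a + b + c) ^ p ≤ 3 ^ p * (a ^ p + b ^ p + c ^ p) := by
    intro m hm h1 h2 h3 h4
    calc (a + b + c) ^ p ≤ (3 * m) ^ p := Real.rpow_le_rpow (by positivity) (by linarith) hp0
      _ = 3 ^ p * m ^ p := Real.mul_rpow (by norm_num) hm
      _ ≤ _ := by gcongr
  have ha' := Real.rpow_nonneg ha p
  have hb' := Real.rpow_nonneg hb p
  have hc' := Real.rpow_nonneg hc p
  rcases le_total a b with h1 | h1 <;> rcases le_total b c with h2 | h2 <;>
    rcases le_total a c with h3 | h3
  · exact key c hc h3 h2 le_rfl (by linarith)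
  · exact key c hc (by linarith) h2 le_rfl (by linarith)
  · exact key b hb h1 le_rfl h2 (by linarith)
  · exact key b hb h1 le_rfl h2 (by linarith)
  · exact key c hc h3 h2 le_rfl (by linarith)
  · exact key a ha le_rfl h1 h3 (by linarith)
  · exact key a ha le_rfl h1 (by linarith) (by linarith)
  · exact key a ha le_rfl h1 h3 (by linarith)

lemma avg_bound (hn : 1 ≤ n) {Ω : Set (Euc n)} (hΩ : IsOpen Ω)
    {s : Euc n → ℝ} {p : ℝ} (hp : 1 ≤ p) {u : Euc n → ℝ} (hu : MemN Ω s p u)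
    {xb c : Euc n} (hxb : xb ∈ frontier Ω) {δ ρ sl T I1 : ℝ} (hδ1 : δ < 1) (hρ : 0 < ρ)
    (hρδ : ρ ≤ δ) (hsl0 : 0 ≤ sl) (hsl : ∀ w ∈ Ω ∩ ball xb δ, sl ≤ s w) (hI0 : 0 ≤ I1)
    (hI : ∫⁻ x in Ω ∩ ball xb ρ, ENNReal.ofReal (|gFun Ω u x - gFun Ω u c| ^ p) ≤
      ENNReal.ofReal I1) (hvol : 0 < volume.real (Ω ∩ ball xb ρ)) :
    ⨍ x in Ω ∩ ball xb ρ, |T - u x| ^ p ≤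
      3 ^ p * (|T - gFun Ω u c| ^ p + (volume.real (Ω ∩ ball xb ρ))⁻¹ *
        (I1 + (4 ^ n) ^ p * ρ ^ (p * sl) * (nuMeas Ω s p u (ball xb ρ)).toReal)) := by
  have hfr : (frontier Ω).Nonempty := ⟨xb, hxb⟩
  have := nuMeas_finite hu
  have hp0 : 0 < p := by linarith
  set E := Ω ∩ ball xb ρ with hE
  have hEm : MeasurableSet E := hΩ.measurableSet.inter measurableSet_ball
  have hEfin : volume E ≠ ∞ := ((measure_mono inter_subset_right).trans_lt measure_ball_lt_top).ne
  set a := |T - gFun Ω u c| ^ p with ha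
  have ha0 : 0 ≤ a := by positivity
  set k2 : ℝ := (4 ^ n) ^ p * ρ ^ (p * sl) with hk2
  have hk20 : 0 ≤ k2 := by positivity
  set M := (nuMeas Ω s p u (ball xb ρ)).toReal with hM
  have hM0 : 0 ≤ M := ENNReal.toReal_nonneg
  have hpt : ∀ x ∈ E, ENNReal.ofReal ‖|T - u x| ^ p‖ ≤ ENNReal.ofReal (3 ^ p) *
      (ENNReal.ofReal a + (ENNReal.ofReal (|gFun Ω u x - gFun Ω u c| ^ p) +
        ENNReal.ofReal k2 * ENNReal.ofReal (nuInt Ω s p u x))) := by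
    rintro x ⟨hx, hxρ⟩
    have hN := nuInt_nonneg Ω s p u x
    have hd := dB_pos hΩ hfr hx
    have hdρ : dB Ω x ≤ ρ := (dB_le_dist hxb).trans (mem_ball.1 hxρ).le
    have h1 := g_sub_u_le hn hΩ hfr hu.1 (x := x) (y := x) (w := x) hx
      (by rw [dist_self]; positivity) (mem_ball_self (by positivity))
    have h2 : |gFun Ω u x - u x| ^ p ≤ k2 * nuInt Ω s p u x := by
      calc _ ≤ (4 ^ n * Amean Ω u x) ^ p := Real.rpow_le_rpow (abs_nonneg _) h1 hp0.le
        _ = (4 ^ n) ^ p * (nuInt Ω s p u x * dB Ω x ^ (p * s x)) := by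
            rw [Real.mul_rpow (by positivity) (Amean_nonneg _ _ _), Amean_rpow hΩ hfr s p u hx]
        _ ≤ (4 ^ n) ^ p * (nuInt Ω s p u x * ρ ^ (p * sl)) := by
            have hsx := hsl x ⟨hx, ball_subset_ball hρδ hxρ⟩
            gcongr
            exact (Real.rpow_le_rpow_of_exponent_ge hd (by linarith) (by gcongr)).trans
              (Real.rpow_le_rpow hd.le hdρ (by positivity))
        _ = _ := by rw [hk2]; ring
    have h3 : |T - u x| ≤ |T - gFun Ω u c| + |gFun Ω u x - gFun Ω u c| + |gFun Ω u x - u x| := by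
      have e1 := abs_sub_le T (gFun Ω u c) (u x)
      have e2 := abs_sub_le (gFun Ω u c) (gFun Ω u x) (u x)
      rw [abs_sub_comm (gFun Ω u c) (gFun Ω u x)] at e2
      linarith
    have h4 : |T - u x| ^ p ≤ 3 ^ p * (a + (|gFun Ω u x - gFun Ω u c| ^ p +
        k2 * nuInt Ω s p u x)) := by
      refine (Real.rpow_le_rpow (abs_nonneg _) h3 hp0.le).trans ?_
      refine (three_rpow (abs_nonneg _) (abs_nonneg _) (abs_nonneg _) hp).trans ?_
      refine mul_le_mul_of_nonneg_left ?_ (by positivity)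
      rw [add_assoc]
      exact add_le_add le_rfl (add_le_add le_rfl h2)
    rw [Real.norm_of_nonneg (by positivity), ← ENNReal.ofReal_mul hk20,
      ← ENNReal.ofReal_add (by positivity) (by positivity),
      ← ENNReal.ofReal_add (by positivity) (by positivity), ← ENNReal.ofReal_mul (by positivity)]
    exact ENNReal.ofReal_le_ofReal h4
  have hNm : AEMeasurable (fun x => ENNReal.ofReal (nuInt Ω s p u x)) (volume.restrict E) :=
    ((hu.2.mono_set inter_subset_left).1.aemeasurable).ennreal_ofReal
  have hnu : ∫⁻ x in E, ENNReal.ofReal (nuInt Ω s p u x) = nuMeas Ω s p u (ball xb ρ) := by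
    rw [nuMeas, withDensity_apply _ measurableSet_ball, Measure.restrict_restrict measurableSet_ball,
      inter_comm]
  have hlin : ∫⁻ x in E, ENNReal.ofReal ‖|T - u x| ^ p‖ ≤
      ENNReal.ofReal (3 ^ p * (a * volume.real E + (I1 + k2 * M))) := by
    calc _ ≤ ∫⁻ x in E, ENNReal.ofReal (3 ^ p) *
          (ENNReal.ofReal a + (ENNReal.ofReal (|gFun Ω u x - gFun Ω u c| ^ p) +
          ENNReal.ofReal k2 * ENNReal.ofReal (nuInt Ω s p u x))) := setLIntegral_mono' hEm hpt
      _ = ENNReal.ofReal (3 ^ p) * (ENNReal.ofReal a * volume E +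
          ((∫⁻ x in E, ENNReal.ofReal (|gFun Ω u x - gFun Ω u c| ^ p)) +
            ENNReal.ofReal k2 * nuMeas Ω s p u (ball xb ρ))) := by
          rw [lintegral_const_mul' _ _ ENNReal.ofReal_ne_top, lintegral_add_left measurable_const,
            setLIntegral_const, lintegral_add_right' _ (hNm.const_mul _),
            lintegral_const_mul' _ _ ENNReal.ofReal_ne_top, hnu]
      _ ≤ ENNReal.ofReal (3 ^ p) * (ENNReal.ofReal a * ENNReal.ofReal (volume.real E) +
          (ENNReal.ofReal I1 + ENNReal.ofReal k2 * ENNReal.ofReal M)) := by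
          rw [hM, ENNReal.ofReal_toReal (measure_ne_top _ _), Measure.real,
            ENNReal.ofReal_toReal hEfin]
          gcongr
      _ = _ := by
          rw [← ENNReal.ofReal_mul ha0, ← ENNReal.ofReal_mul hk20,
            ← ENNReal.ofReal_add hI0 (by positivity),
            ← ENNReal.ofReal_add (by positivity) (by positivity),
            ← ENNReal.ofReal_mul (by positivity)]
  have hfinal : ∫ x in E, |T - u x| ^ p ≤ 3 ^ p * (a * volume.real E + (I1 + k2 * M)) := by
    refine (le_abs_self _).trans ?_
    rw [← Real.norm_eq_abs]
    refine (norm_integral_le_lintegral_norm _).trans ?_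
    exact ENNReal.toReal_le_of_le_ofReal (by positivity) hlin
  rw [setAverage_eq, smul_eq_mul]
  calc _ ≤ (volume.real E)⁻¹ * (3 ^ p * (a * volume.real E + (I1 + k2 * M))) := by gcongr
    _ = _ := by field_simp

lemma alphaFun_le (n : ℕ) {p sl θ : ℝ} (hθ : 1 ≤ θ) :
    alphaFun n p sl θ ≤ p * sl - n := by
  unfold alphaFun
  split_ifs with h
  · nlinarith
  · linarith

lemma vol_lower (hn : 1 ≤ n) {Ω : Set (Euc n)} (hΩ : IsOpen Ω) {xb x : Euc n}
    (hxb : xb ∈ frontier Ω) {η θ ρ : ℝ} (hη : 0 < η) (hρ : 0 < ρ) (hx : x ∈ Ω)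
    (hd : dist xb x < ρ / 2) (hdB : (η * (ρ / 2)) ^ θ < dB Ω x) :
    (η / 2) ^ (θ * n) * volume.real (ball (0 : Euc n) 1) * ρ ^ (θ * n) ≤
      volume.real (Ω ∩ ball xb ρ) := by
  have hr0 : 0 ≤ (η * (ρ / 2)) ^ θ := by positivity
  have h1 : dB Ω x ≤ dist x xb := dB_le_dist hxb
  have hsub : ball x ((η * (ρ / 2)) ^ θ) ⊆ Ω ∩ ball xb ρ := by
    refine subset_inter (ball_dB_subset hΩ hx hdB.le) (ball_subset_ball' ?_)
    rw [dist_comm] at hd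
    linarith
  have h2 : volume.real (ball x ((η * (ρ / 2)) ^ θ)) ≤ volume.real (Ω ∩ ball xb ρ) :=
    measureReal_mono hsub ((measure_mono inter_subset_right).trans_lt measure_ball_lt_top).ne
  rw [vol_ball hn x hr0, ← Real.rpow_natCast, ← Real.rpow_mul (by positivity),
    show η * (ρ / 2) = η / 2 * ρ by ring, Real.mul_rpow (by positivity) hρ.le] at h2
  linarith

lemma point_limit (hn : 1 ≤ n) {Ω : Set (Euc n)} (hΩ : IsOpen Ω)
    {s : Euc n → ℝ} {p : ℝ} (hp : 1 ≤ p) {u : Euc n → ℝ} (hu : MemN Ω s p u)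
    {xb : Euc n} (hxb : xb ∈ frontier Ω) {δ η θ lam C Kt α sl t ρ1 T : ℝ}
    (hδ0 : 0 < δ) (hδ1 : δ < 1) (hη : 0 < η) (hη1 : η < 1) (hθ : 1 ≤ θ) (hC : 1 ≤ C)
    (hKt : 0 ≤ Kt) (hρ1 : 0 < ρ1)
    (hsl0 : 0 ≤ sl) (hsl : ∀ w ∈ Ω ∩ ball xb δ, sl ≤ s w)
    (h1 : IsCorkscrew Ω (Qreg Ω lam θ xb) xb η θ δ)
    (hgbd : ∀ ρ : ℝ, 0 < ρ → 8 * ρ ≤ ρ1 → ∀ c ∈ Ω,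
      dist xb c < ρ → (η * ρ) ^ θ < dB Ω c →
      ∫⁻ x in Ω ∩ ball xb ρ, ENNReal.ofReal (|gFun Ω u x - gFun Ω u c| ^ p) ≤
        ENNReal.ofReal (Kt * ρ ^ (α + n)) * nuMeas Ω s p u (ball xb (41 * C * ρ)))
    (hdens : ∀ᶠ ρ in 𝓝[>] (0:ℝ), nuMeas Ω s p u (ball xb ρ) ≤ ENNReal.ofReal (ρ ^ t))
    (hT : Tendsto (gFun Ω u) (𝓝[Qreg Ω lam θ xb] xb) (𝓝 T))
    (he1 : 0 < α + n + t - θ * n) (he2 : 0 < p * sl + t - θ * n) :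
    Tendsto (fun ρ : ℝ => ⨍ x in Ω ∩ ball xb ρ, |T - u x| ^ p) (𝓝[>] (0:ℝ)) (𝓝 0) := by
  have hp0 : 0 < p := by linarith
  have hfin := nuMeas_finite hu
  have hex : ∀ ρ : ℝ, ∃ x, 0 < ρ → ρ ≤ δ → x ∈ Qreg Ω lam θ xb ∧ dist xb x < ρ ∧
      (η * ρ) ^ θ < dB Ω x := by
    intro ρ
    by_cases h : 0 < ρ ∧ ρ ≤ δ
    · obtain ⟨x, hx, -, hx2, hx3⟩ := h1 ρ h.1 h.2
      exact ⟨x, fun _ _ => ⟨hx, hx2, hx3⟩⟩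
    · exact ⟨xb, fun h3 h4 => (h ⟨h3, h4⟩).elim⟩
  choose c hc using hex
  have hδev : ∀ᶠ ρ in 𝓝[>] (0:ℝ), ρ ≤ δ :=
    mem_nhdsWithin_of_mem_nhds (Iic_mem_nhds hδ0)
  have hρev : ∀ᶠ ρ in 𝓝[>] (0:ℝ), 8 * ρ ≤ ρ1 := by
    have : ∀ᶠ ρ in 𝓝[>] (0:ℝ), ρ ≤ ρ1 / 8 :=
      mem_nhdsWithin_of_mem_nhds (Iic_mem_nhds (by positivity))
    filter_upwards [this] with ρ h
    linarith
  have hposev : ∀ᶠ ρ in 𝓝[>] (0:ℝ), 0 < ρ := self_mem_nhdsWithin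
  have hid : Tendsto (fun ρ : ℝ => ρ) (𝓝[>] (0:ℝ)) (𝓝 0) := tendsto_nhdsWithin_of_tendsto_nhds tendsto_id
  have hcT : Tendsto c (𝓝[>] (0:ℝ)) (𝓝[Qreg Ω lam θ xb] xb) := by
    rw [tendsto_nhdsWithin_iff]
    constructor
    · rw [tendsto_iff_dist_tendsto_zero]
      refine squeeze_zero' (Eventually.of_forall fun _ => dist_nonneg) ?_ hid
      filter_upwards [hδev, hposev] with ρ h2 h3
      rw [dist_comm]
      exact (hc ρ h3 h2).2.1.le
    · filter_upwards [hδev, hposev] with ρ h2 h3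
      exact (hc ρ h3 h2).1
  have hterm : Tendsto (fun ρ => |T - gFun Ω u (c ρ)| ^ p) (𝓝[>] (0:ℝ)) (𝓝 0) := by
    have h := ((tendsto_const_nhds (x := T)).sub (hT.comp hcT)).abs.rpow_const (p := p)
      (Or.inr hp0.le)
    simpa [Real.zero_rpow hp0.ne'] using h
  have hrpow : ∀ e : ℝ, 0 < e → Tendsto (fun ρ : ℝ => ρ ^ e) (𝓝[>] (0:ℝ)) (𝓝 0) := by
    intro e he
    have h := hid.rpow_const (p := e) (Or.inr he.le)
    simpa [Real.zero_rpow he.ne'] using h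
  have hC0 : 0 < 41 * C := by linarith
  have hdens2 : ∀ᶠ ρ in 𝓝[>] (0:ℝ), nuMeas Ω s p u (ball xb (41 * C * ρ)) ≤
      ENNReal.ofReal ((41 * C * ρ) ^ t) := by
    have ht : Tendsto (fun ρ : ℝ => 41 * C * ρ) (𝓝[>] (0:ℝ)) (𝓝[>] (0:ℝ)) := by
      rw [tendsto_nhdsWithin_iff]
      constructor
      · simpa using hid.const_mul (41 * C)
      · filter_upwards [hposev] with ρ h
        exact mul_pos hC0 h
    exact ht.eventually hdens
  have hv := vol_one_pos (n := n)
  set v0 : ℝ := (η / 2) ^ (θ * n) * volume.real (ball (0 : Euc n) 1) with hv0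
  have hv0p : 0 < v0 := by positivity
  have hlim : Tendsto (fun ρ : ℝ => 3 ^ p * (|T - gFun Ω u (c ρ)| ^ p +
      (v0⁻¹ * Kt * (41 * C) ^ t * ρ ^ (α + n + t - θ * n) +
        v0⁻¹ * (4 ^ n) ^ p * ρ ^ (p * sl + t - θ * n)))) (𝓝[>] (0:ℝ)) (𝓝 0) := by
    have h := (hterm.add (((hrpow _ he1).const_mul (v0⁻¹ * Kt * (41 * C) ^ t)).add
      ((hrpow _ he2).const_mul (v0⁻¹ * (4 ^ n) ^ p)))).const_mul ((3:ℝ) ^ p)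
    simpa using h
  refine squeeze_zero' (Eventually.of_forall fun ρ => ?_) ?_ hlim
  · rw [setAverage_eq, smul_eq_mul]
    exact mul_nonneg (by positivity) (integral_nonneg fun x => by positivity)
  filter_upwards [hδev, hρev, hposev, hdens, hdens2] with ρ hρδ hρρ hρ hd1 hd2
  obtain ⟨hcQ, hcd, hcB⟩ := hc ρ hρ hρδ
  obtain ⟨x, hxQ, -, hxd, hxB⟩ := h1 (ρ / 2) (by positivity) (by linarith)
  have hvl := vol_lower hn hΩ hxb hη hρ hxQ.1 hxd hxB
  rw [← hv0] at hvl
  have hvpos : 0 < v0 * ρ ^ (θ * n) := by positivity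
  have hI := hgbd ρ hρ hρρ (c ρ) hcQ.1 hcd hcB
  have hI' : ∫⁻ x in Ω ∩ ball xb ρ, ENNReal.ofReal (|gFun Ω u x - gFun Ω u (c ρ)| ^ p) ≤
      ENNReal.ofReal (Kt * ρ ^ (α + n) * (41 * C * ρ) ^ t) := by
    rw [ENNReal.ofReal_mul (by positivity)]
    exact hI.trans (by gcongr)
  refine (avg_bound (T := T) hn hΩ hp hu hxb hδ1 hρ hρδ hsl0 hsl (by positivity) hI'
    (hvpos.trans_le hvl)).trans ?_
  have hM : (nuMeas Ω s p u (ball xb ρ)).toReal ≤ ρ ^ t :=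
    ENNReal.toReal_le_of_le_ofReal (by positivity) hd1
  have hinv : (volume.real (Ω ∩ ball xb ρ))⁻¹ ≤ (v0 * ρ ^ (θ * n))⁻¹ := inv_anti₀ hvpos hvl
  have hmain : (volume.real (Ω ∩ ball xb ρ))⁻¹ * (Kt * ρ ^ (α + n) * (41 * C * ρ) ^ t +
      (4 ^ n) ^ p * ρ ^ (p * sl) * (nuMeas Ω s p u (ball xb ρ)).toReal) ≤
      v0⁻¹ * Kt * (41 * C) ^ t * ρ ^ (α + n + t - θ * n) +
        v0⁻¹ * (4 ^ n) ^ p * ρ ^ (p * sl + t - θ * n) := by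
    calc _ ≤ (v0 * ρ ^ (θ * n))⁻¹ * (Kt * ρ ^ (α + n) * (41 * C * ρ) ^ t +
          (4 ^ n) ^ p * ρ ^ (p * sl) * ρ ^ t) := by gcongr
      _ = _ := by
        rw [Real.mul_rpow hC0.le hρ.le, Real.rpow_sub hρ, Real.rpow_sub hρ,
          Real.rpow_add hρ (α + n) t, Real.rpow_add hρ (p * sl) t]
        field_simp
  gcongr

lemma nuMeas_frontier {Ω : Set (Euc n)} (hΩ : IsOpen Ω) (s : Euc n → ℝ) (p : ℝ)
    (u : Euc n → ℝ) : nuMeas Ω s p u (frontier Ω) = 0 := by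
  refine withDensity_absolutelyContinuous _ _ ?_
  rw [Measure.restrict_apply isClosed_frontier.measurableSet, hΩ.frontier_eq, sdiff_inter_self,
    measure_empty]

/-- a.e. Lebesgue point property of the trace. Under (H1), (H2), (H3″), (H4′)
and (H4″), with `Γ = ∂Ω` and `α̲_Γ > n(θ_Γ(xb) − 1) − t` for all `xb ∈ Γ`, the trace `Tu`
satisfies `⨍_{Ω∩B(xb,ρ)} |Tu(xb) − u|ᵖ dx → 0` as `ρ → 0⁺` for `H^t`-a.e. `xb ∈ Γ`. -/
theorem statement18 (n : ℕ) (hn : 1 ≤ n) (p t AΓ CΓ δΓ : ℝ)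
    (hp : 1 ≤ p) (ht : 0 ≤ t) (htn : t < n) (hAΓ : 1 ≤ AΓ) (hCΓ : 1 ≤ CΓ)
    (hδΓ0 : 0 < δΓ) (hδΓ1 : δΓ < 1)
    (Ω : Set (Euc n)) (hΩo : IsOpen Ω) (hΩne : Ω.Nonempty) (hfr : (frontier Ω).Nonempty)
    (Γ : Set (Euc n)) (hΓeq : Γ = frontier Ω)
    (θΓ : Euc n → ℝ) (hθ1 : ∀ xb, 1 ≤ θΓ xb) (hθb : ∃ b : ℝ, ∀ xb, θΓ xb ≤ b)
    (s : Euc n → ℝ) (hsm : Measurable s) (hs0 : ∀ x, 0 ≤ s x) (hsb : ∃ b : ℝ, ∀ x, s x ≤ b)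
    (lam₀ η₀ : ℝ) (hlam₀ : 0 < lam₀) (hlam₀1 : lam₀ < 1) (hη₀ : 0 < η₀) (hη₀1 : η₀ < 1)
    (H1 : ∀ xb ∈ Γ, IsCorkscrew Ω (Qreg Ω lam₀ (θΓ xb) xb) xb η₀ (θΓ xb) δΓ)
    (ε : ℝ → ℝ) (hεmono : ∀ a b : ℝ, 0 < a → a ≤ b → b < 1 → ε a ≤ ε b)
    (H2 : ∀ xb ∈ Γ, ConnectedTo Ω (Ω ∩ ball xb δΓ) xb CΓ (θΓ xb) (δΓ / (3 * CΓ)) ε)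
    (H4' : ∀ xb ∈ Γ, ∀ ρ : ℝ, 0 < ρ → μH[t] (Γ ∩ ball xb ρ) ≤ ENNReal.ofReal (AΓ * ρ ^ t))
    (H4'' : ∀ xb ∈ Γ, ∀ ρ : ℝ, 0 < ρ → ENNReal.ofReal ρ ≤ EMetric.diam Γ →
      ENNReal.ofReal (AΓ⁻¹ * ρ ^ t) ≤ μH[t] (Γ ∩ ball xb ρ))
    (αΓ : ℝ) (hαΓglb : IsGLB ((fun xb => alphaLow Ω s p θΓ xb δΓ) '' Γ) αΓ)
    (H3'' : -t < αΓ)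
    (hαθ : ∀ xb ∈ Γ, n * (θΓ xb - 1) - t < αΓ)
    (u : Euc n → ℝ) (hu : MemN Ω s p u)
    (Tu : Euc n → ℝ) (hTum : AEMeasurable Tu (μH[t].restrict Γ))
    (hTu : ∀ᵐ xb ∂(μH[t].restrict Γ),
      Tendsto (gFun Ω u) (𝓝[Qreg Ω lam₀ (θΓ xb) xb] xb) (𝓝 (Tu xb))) :
    ∀ᵐ xb ∂(μH[t].restrict Γ),
      Tendsto (fun ρ : ℝ => ⨍ x in Ω ∩ ball xb ρ, |Tu xb - u x| ^ p)
        (𝓝[>] (0:ℝ)) (𝓝 0) := by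
  subst hΓeq
  obtain ⟨b, hb⟩ := hsb
  obtain ⟨z0, hz0⟩ := hfr
  have hfr : (frontier Ω).Nonempty := ⟨z0, hz0⟩
  have hfin := nuMeas_finite hu
  have hCpos : 0 < CΓ := by linarith
  set e := ε (η₀ / 8) with he
  obtain ⟨he0, hele, -⟩ := H2 z0 hz0 (η₀ / 8) (by positivity) (by linarith)
  have he1 : e ≤ 1 := by linarith
  set ρ1 := δΓ / (4 * CΓ) with hρ1
  have hρ1pos : 0 < ρ1 := by positivity
  have hρ1δ : 4 * CΓ * ρ1 = δΓ := by rw [hρ1]; field_simp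
  have hρ1le : ρ1 ≤ δΓ := by nlinarith
  have hρ13 : ρ1 ≤ δΓ / (3 * CΓ) := by
    rw [hρ1]; gcongr; norm_num
  have hcork : ∀ z ∈ frontier Ω, ∀ δ : ℝ, 0 < δ → δ ≤ ρ1 →
      ∃ x ∈ Ω, dist z x < δ ∧ (η₀ * δ) ^ θΓ z < dB Ω x := by
    intro z hz δ hδ hδρ
    obtain ⟨x, hx, -, h2, h3⟩ := H1 z hz δ hδ (hδρ.trans hρ1le)
    exact ⟨x, hx.1, h2, h3⟩
  have hbdd : ∀ z, BddBelow (s '' (Ω ∩ ball z δΓ)) := by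
    intro z
    refine ⟨0, ?_⟩
    rintro _ ⟨x, -, rfl⟩
    exact hs0 x
  have hsl : ∀ z, ∀ w ∈ Ω ∩ ball z δΓ, sLow Ω s z δΓ ≤ s w := fun z w hw =>
    csInf_le (hbdd z) ⟨w, hw, rfl⟩
  have hsl0 : ∀ z, 0 ≤ sLow Ω s z δΓ := by
    intro z
    refine Real.sInf_nonneg ?_
    rintro _ ⟨x, -, rfl⟩
    exact hs0 x
  have hslb : ∀ z ∈ frontier Ω, sLow Ω s z δΓ ≤ b := by
    intro z hz
    obtain ⟨x, hx, h2, -⟩ := hcork z hz ρ1 hρ1pos le_rfl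
    refine (hsl z x ⟨hx, ?_⟩).trans (hb x)
    rw [mem_ball, dist_comm]
    linarith
  have hαle : ∀ z ∈ frontier Ω, αΓ ≤ alphaFun n p (sLow Ω s z δΓ) (θΓ z) := fun z hz =>
    hαΓglb.1 ⟨z, hz, rfl⟩
  have hcon : ∀ z ∈ frontier Ω, ∀ ρ : ℝ, 0 < ρ → ρ ≤ ρ1 → ∀ x ∈ Ω ∩ ball z ρ,
      ∀ x' ∈ Ω ∩ ball z ρ, (η₀ / 8 * ρ) ^ θΓ z ≤ dB Ω x → (η₀ / 8 * ρ) ^ θΓ z ≤ dB Ω x' →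
      |gFun Ω u x - gFun Ω u x'| ^ p ≤ Ccon n p CΓ b e * ρ ^ αΓ *
        (nuMeas Ω s p u (ball z (4 * CΓ * ρ))).toReal := by
    intro z hz ρ hρ hρρ x hx x' hx' hdx hdx'
    have hsub : ball z ρ ⊆ ball z δΓ := ball_subset_ball (hρρ.trans hρ1le)
    obtain ⟨γ, hγc, hγ0, hγ1, hγE, hγV⟩ := (H2 z hz (η₀ / 8) (by positivity) (by linarith)).2.2
      ρ hρ (hρρ.trans hρ13) x ⟨⟨hx.1, hsub hx.2⟩, hx.2⟩ x' ⟨⟨hx'.1, hsub hx'.2⟩, hx'.2⟩ hdx hdx'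
    have h := connect_bound hn hΩo hp hu hz (b := b) hCΓ hδΓ1 hρ
      (by rw [← hρ1δ]; gcongr) (hθ1 z) he0 he1 (hsl0 z) (hslb z hz) (hsl z) (hαle z hz) γ hγc
      (by rw [hγ0]; exact hx.2) (fun τ hτ => ⟨(hγE τ hτ).1.1, (hγE τ hτ).2⟩) hγV
    rwa [hγ0, hγ1] at h
  have hn0 : (0:ℝ) ≤ n := by positivity
  have hαn : 0 < αΓ + n := by linarith
  obtain ⟨Kt, hKt, hKint⟩ := g_int hn hΩo hfr hθ1 hp hCΓ hη₀ hη₀1 (by linarith : ρ1 ≤ 1) hcon hcork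
    (Ccon_pos n hCΓ he0).le hαn
  filter_upwards [hTu, ae_restrict_mem isClosed_frontier.measurableSet,
    density_zero (nuMeas Ω s p u) (frontier Ω) isClosed_frontier.measurableSet
      (nuMeas_frontier hΩo s p u) t ht] with xb hT hxb hd
  have ha1 := hαθ xb hxb
  have ha2 := (hαle xb hxb).trans (alphaFun_le n (hθ1 xb))
  refine point_limit (α := αΓ) (t := t) hn hΩo hp hu hxb hδΓ0 hδΓ1 hη₀ hη₀1 (hθ1 xb) hCΓ hKt hρ1pos
    (hsl0 xb) (hsl xb) (H1 xb hxb) (hKint xb hxb) ?_ hT (by linarith) (by linarith)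
  simpa using hd 1 one_ne_zero
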